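/- arXiv:2211.14973 — 3 statements merged into one kernel-verified Lean document; each statement's English description precedes it below -/
import Mathlib

section
/- In the two-player (c,k)-nacci Zeckendorf game on n with k > 1 and n >= (c+1)^3 + (c+1), each of the first c turns admits exactly one legal move, and on turn c+1 (the earliest turn with more than one legal move, which belongs to the player holding the winning strategy: Player 1 if c is even, Player 2 if c is odd) there exists a legal move for that player after which the opposing player has a winning strategy for the remainder of the game. -/
/-- The `(c,k)`-nacci numbers: `nacci c k 1 = 1`,
`nacci c k (i+1) = c * (nacci c k i + ⋯ + nacci c k 1) + 1` for `1 ≤ i ≤ k`, and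
`nacci c k (i+1) = c * (nacci c k i + ⋯ + nacci c k (i-k))` for `i ≥ k + 1`.
(The value at `0` is junk.) -/
def nacci (c k : ℕ) : ℕ → ℕ
  | 0 => 0
  | 1 => 1
  | (i + 2) =>
    if i + 1 ≤ k then
      c * ((Finset.range (i + 1)).attach.sum fun j => nacci c k (j.1 + 1)) + 1
    else
      c * ((Finset.Icc (i + 1 - k) (i + 1)).attach.sum fun j => nacci c k j.1)
decreasing_by
  · have hj := j.2
    simp only [Finset.mem_range] at hj
    omega
  · have hj := j.2
    simp only [Finset.mem_Icc] at hj
    omega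


/-- The multiset consisting of `c` copies of `nacci c k j` for each `j` in the
finite set `s`. -/
def nacciBlock (c k : ℕ) (s : Finset ℕ) : Multiset ℕ :=
  s.val.bind fun j => Multiset.replicate c (nacci c k j)

/-- A legal move of the `(c,k)`-nacci Zeckendorf game, as a relation between the
position before and the position after the move (positions are multisets of naturals). -/
def CkMove (c k : ℕ) (A B : Multiset ℕ) : Prop :=
  -- (1) for `i ≥ k+1`: `c` copies each of `S_{i-k}, …, S_i` become `S_{i+1}`
  (∃ i, k + 1 ≤ i ∧ nacciBlock c k (Finset.Icc (i - k) i) ≤ A ∧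
    B = A - nacciBlock c k (Finset.Icc (i - k) i) + {nacci c k (i + 1)}) ∨
  -- (2) for `2 ≤ i ≤ k`: `c+1` copies of `S_1` and `c` copies each of `S_2, …, S_i`
  -- become `S_{i+1}`
  (∃ i, 2 ≤ i ∧ i ≤ k ∧
    Multiset.replicate (c + 1) (nacci c k 1) + nacciBlock c k (Finset.Icc 2 i) ≤ A ∧
    B = A - (Multiset.replicate (c + 1) (nacci c k 1) + nacciBlock c k (Finset.Icc 2 i))
        + {nacci c k (i + 1)}) ∨
  -- (3) `c+1` copies of `S_1` become `S_2`
  (Multiset.replicate (c + 1) (nacci c k 1) ≤ A ∧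
    B = A - Multiset.replicate (c + 1) (nacci c k 1) + {nacci c k 2}) ∨
  -- (3) for `1 < i < k+1`: `c+1` copies of `S_i` become `S_{i+1}`
  (∃ i, 1 < i ∧ i < k + 1 ∧ Multiset.replicate (c + 1) (nacci c k i) ≤ A ∧
    B = A - Multiset.replicate (c + 1) (nacci c k i) + {nacci c k (i + 1)}) ∨
  -- (3) `c+1` copies of `S_{k+1}` become `S_{k+2}` and `S_1`
  (Multiset.replicate (c + 1) (nacci c k (k + 1)) ≤ A ∧
    B = A - Multiset.replicate (c + 1) (nacci c k (k + 1))
        + {nacci c k (k + 2), nacci c k 1}) ∨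
  -- (3) for `i > k+1`: `c+1` copies of `S_i` become `S_{i+1}` and `c` copies of `S_{i-k-1}`
  (∃ i, k + 1 < i ∧ Multiset.replicate (c + 1) (nacci c k i) ≤ A ∧
    B = A - Multiset.replicate (c + 1) (nacci c k i)
        + ({nacci c k (i + 1)} + Multiset.replicate c (nacci c k (i - k - 1))))

/-- A position is terminal when no legal move remains. -/
def Terminal (Move : Multiset ℕ → Multiset ℕ → Prop) (pos : Multiset ℕ) : Prop :=
  ∀ B, ¬ Move pos B

/-- `AllianceWins Move p team t pos`: in the `p`-player game with move relation `Move`,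
where players `1, …, p` move cyclically (the mover of the `t`-th move, counting from `t = 0`,
is player `t % p + 1`) and the side making the last legal move wins, the alliance
(set of players) `team` can guarantee, from position `pos` with `t` moves already made,
that one of its members makes the last move, no matter how the other players play. -/
inductive AllianceWins (Move : Multiset ℕ → Multiset ℕ → Prop) (p : ℕ) (team : ℕ → Prop) :
    ℕ → Multiset ℕ → Prop
  | endMove (t : ℕ) (pos B : Multiset ℕ) (hturn : team (t % p + 1)) (hmove : Move pos B)
      (hterm : Terminal Move B) : AllianceWins Move p team t pos
  | contMove (t : ℕ) (pos B : Multiset ℕ) (hturn : team (t % p + 1)) (hmove : Move pos B)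
      (hwin : AllianceWins Move p team (t + 1) B) : AllianceWins Move p team t pos
  | oppMove (t : ℕ) (pos : Multiset ℕ) (hturn : ¬ team (t % p + 1))
      (hex : ∃ B, Move pos B)
      (hall : ∀ B, Move pos B → AllianceWins Move p team (t + 1) B) :
      AllianceWins Move p team t pos

/-- Player `m` has a winning strategy in the `p`-player game on `n`
(played from `n` copies of `1`, with player 1 moving first). -/
def PlayerWins (Move : Multiset ℕ → Multiset ℕ → Prop) (p m n : ℕ) : Prop :=
  AllianceWins Move p (fun q => q = m) 0 (Multiset.replicate n 1)

section Generic

/-- The player to move wins. -/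
inductive NWin (Move : Multiset ℕ → Multiset ℕ → Prop) : Multiset ℕ → Prop
  | mk (A B : Multiset ℕ) (h : Move A B) (hall : ∀ C, Move B C → NWin Move C) : NWin Move A

/-- The player who just moved wins. -/
def PWin (Move : Multiset ℕ → Multiset ℕ → Prop) (A : Multiset ℕ) : Prop :=
  ∀ B, Move A B → NWin Move B

theorem NWin.of {Move : Multiset ℕ → Multiset ℕ → Prop} {A B : Multiset ℕ} (h : Move A B)
    (hB : PWin Move B) : NWin Move A := NWin.mk A B h hB

theorem NWin.ex {Move : Multiset ℕ → Multiset ℕ → Prop} {A : Multiset ℕ} (h : NWin Move A) :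
    ∃ B, Move A B ∧ PWin Move B := by
  cases h with
  | mk _ B h hall => exact ⟨B, h, hall⟩

theorem dichotomy {Move : Multiset ℕ → Multiset ℕ → Prop} (f : Multiset ℕ → ℕ)
    (hf : ∀ A B, Move A B → f B < f A) (A : Multiset ℕ) : NWin Move A ∨ PWin Move A := by
  induction h : f A using Nat.strong_induction_on generalizing A with
  | _ N ih =>
    by_cases hP : ∃ B, Move A B ∧ PWin Move B
    · obtain ⟨B, h1, h2⟩ := hP
      exact Or.inl (NWin.of h1 h2)
    · right
      intro B hB
      rcases ih (f B) (h ▸ hf A B hB) B rfl with h1 | h1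
      · exact h1
      · exact absurd ⟨B, hB, h1⟩ hP

theorem NWin.alliance {Move : Multiset ℕ → Multiset ℕ → Prop} {A : Multiset ℕ}
    (h : NWin Move A) : ∀ t m : ℕ, t % 2 + 1 = m →
      AllianceWins Move 2 (fun q => q = m) t A := by
  induction h with
  | mk A B h hall ih =>
    intro t m htm
    by_cases hT : ∃ C, Move B C
    · refine AllianceWins.contMove t A B htm h ?_
      refine AllianceWins.oppMove (t+1) B ?_ hT ?_
      · show ¬ ((t+1) % 2 + 1 = m)
        omega
      · intro C hC
        exact ih C hC (t+1+1) m (by omega)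
    · exact AllianceWins.endMove t A B htm h (fun C hC => hT ⟨C, hC⟩)

theorem PWin.alliance {Move : Multiset ℕ → Multiset ℕ → Prop} {A : Multiset ℕ}
    (h : PWin Move A) (hex : ∃ B, Move A B) (t m : ℕ) (htm : (t + 1) % 2 + 1 = m) :
      AllianceWins Move 2 (fun q => q = m) t A := by
  refine AllianceWins.oppMove t A ?_ hex ?_
  · show ¬ (t % 2 + 1 = m)
    omega
  · intro C hC
    exact (h C hC).alliance (t+1) m htm

/-- Outcome with parity. -/
def Outc (Move : Multiset ℕ → Multiset ℕ → Prop) (p : ℕ) (A : Multiset ℕ) : Prop :=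
  (Even p → NWin Move A) ∧ (¬ Even p → PWin Move A)

theorem Outc.step {Move : Multiset ℕ → Multiset ℕ → Prop} {p : ℕ} {A B : Multiset ℕ}
    (h : Outc Move p B) (h1 : PWin Move B → NWin Move A) (h2 : NWin Move B → PWin Move A) :
    Outc Move (p+1) A := by
  constructor
  · intro hp
    exact h1 (h.2 (Nat.even_add_one.mp hp))
  · intro hp
    refine h2 (h.1 ?_)
    by_contra hc
    exact hp (Nat.even_add_one.mpr hc)

end Generic

section Numbers

theorem nacci_one (c k : ℕ) : nacci c k 1 = 1 := by
  rw [nacci]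

theorem nacci_low (c k i : ℕ) (h1 : 1 ≤ i) (hi : i ≤ k) :
    nacci c k (i+1) = c * (∑ j ∈ Finset.Icc 1 i, nacci c k j) + 1 := by
  obtain ⟨i, rfl⟩ : ∃ i', i = i' + 1 := ⟨i - 1, by omega⟩
  rw [nacci, if_pos hi, Finset.sum_attach (Finset.range (i+1)) (fun j => nacci c k (j+1))]
  congr 2
  rw [Finset.range_eq_Ico, Finset.sum_Ico_add' (fun j => nacci c k j) 0 (i+1) 1]
  rfl

theorem nacci_high (c k i : ℕ) (hi : k + 1 ≤ i) :
    nacci c k (i+1) = c * (∑ j ∈ Finset.Icc (i-k) i, nacci c k j) := by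
  obtain ⟨i, rfl⟩ : ∃ i', i = i' + 1 := ⟨i - 1, by omega⟩
  rw [nacci, if_neg (by omega), Finset.sum_attach (Finset.Icc (i+1-k) (i+1)) (fun j => nacci c k j)]

theorem nacci_pos (c k : ℕ) (hc : 1 ≤ c) (i : ℕ) (hi : 1 ≤ i) : 1 ≤ nacci c k i := by
  induction i using Nat.strong_induction_on with
  | _ i ih =>
    obtain ⟨i, rfl⟩ : ∃ i', i = i' + 1 := ⟨i - 1, by omega⟩
    rcases Nat.eq_zero_or_pos i with rfl | h0
    · rw [nacci_one]
    · by_cases hik : i ≤ k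
      · rw [nacci_low c k i h0 hik]; omega
      · rw [nacci_high c k i (by omega)]
        have h1 := ih i (by omega) h0
        have h2 : nacci c k i ≤ ∑ j ∈ Finset.Icc (i-k) i, nacci c k j :=
          Finset.single_le_sum (f := fun j => nacci c k j) (fun _ _ => Nat.zero_le _)
            (Finset.mem_Icc.mpr ⟨by omega, le_refl _⟩)
        exact Nat.mul_pos hc (by omega)

theorem nacci_lt_succ (c k : ℕ) (hc : 1 ≤ c) (hk : 1 < k) (i : ℕ) (hi : 1 ≤ i) :
    nacci c k i < nacci c k (i+1) := by
  by_cases hik : i ≤ k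
  · rw [nacci_low c k i hi hik]
    have h2 : nacci c k i ≤ ∑ j ∈ Finset.Icc 1 i, nacci c k j :=
      Finset.single_le_sum (f := fun j => nacci c k j) (fun _ _ => Nat.zero_le _)
        (Finset.mem_Icc.mpr ⟨by omega, le_refl _⟩)
    nlinarith
  · rw [nacci_high c k i (by omega)]
    have h1 := nacci_pos c k hc (i-1) (by omega)
    have h2 : ∑ j ∈ ({i-1, i} : Finset ℕ), nacci c k j
        ≤ ∑ j ∈ Finset.Icc (i-k) i, nacci c k j := by
      apply Finset.sum_le_sum_of_subset
      intro x hx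
      simp only [Finset.mem_insert, Finset.mem_singleton] at hx
      rw [Finset.mem_Icc]
      omega
    rw [Finset.sum_pair (show i - 1 ≠ i by omega)] at h2
    nlinarith

theorem nacci_lt (c k : ℕ) (hc : 1 ≤ c) (hk : 1 < k) (i j : ℕ) (hi : 1 ≤ i) (hij : i < j) :
    nacci c k i < nacci c k j := by
  induction j with
  | zero => omega
  | succ j ih =>
    have := nacci_lt_succ c k hc hk j (by omega)
    rcases Nat.lt_or_ge i j with h | h
    · exact (ih h).trans this
    · obtain rfl : i = j := by omega
      exact this

theorem nacci_inj (c k : ℕ) (hc : 1 ≤ c) (hk : 1 < k) (i j : ℕ) (hi : 1 ≤ i) (hj : 1 ≤ j) :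
    nacci c k i = nacci c k j ↔ i = j := by
  constructor
  · intro h
    rcases Nat.lt_trichotomy i j with h1 | h1 | h1
    · have := nacci_lt c k hc hk i j hi h1
      omega
    · exact h1
    · have := nacci_lt c k hc hk j i hj h1
      omega
  · rintro rfl; rfl

theorem nacci_two (c k : ℕ) (hk : 1 < k) : nacci c k 2 = c + 1 := by
  rw [nacci_low c k 1 le_rfl (by omega)]
  simp [nacci_one]

/-- `(c+1) S_i = S_{i+1}` for `1 ≤ i ≤ k`. -/
theorem nacci_geom (c k i : ℕ) (h1 : 1 ≤ i) (hi : i ≤ k) :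
    (c + 1) * nacci c k i = nacci c k (i+1) := by
  obtain ⟨i, rfl⟩ : ∃ i', i = i' + 1 := ⟨i - 1, by omega⟩
  rw [nacci_low c k (i+1) h1 hi, Finset.sum_Icc_succ_top (by omega)]
  rcases Nat.eq_zero_or_pos i with rfl | h0
  · simp [nacci_one]
  · have := nacci_low c k i h0 (by omega)
    rw [mul_add]
    nlinarith

theorem nacci_mid (c k : ℕ) :
    (c + 1) * nacci c k (k+1) = nacci c k (k+2) + 1 := by
  rw [nacci_high c k (k+1) le_rfl, Finset.sum_Icc_succ_top (by omega)]
  rcases Nat.eq_zero_or_pos k with rfl | h0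
  · simp [nacci_one]
  · have := nacci_low c k k h0 le_rfl
    rw [show k + 1 - k = 1 by omega]
    rw [mul_add]
    nlinarith

theorem nacci_top (c k i : ℕ) (hi : k + 1 < i) :
    (c + 1) * nacci c k i = nacci c k (i+1) + c * nacci c k (i-k-1) := by
  obtain ⟨i, rfl⟩ : ∃ i', i = i' + 1 := ⟨i - 1, by omega⟩
  rw [nacci_high c k (i+1) (by omega), Finset.sum_Icc_succ_top (by omega)]
  have h := nacci_high c k i (by omega)
  have h3 : ∑ j ∈ Finset.Icc (i-k) i, nacci c k j
      = nacci c k (i-k) + ∑ j ∈ Finset.Icc (i+1-k) i, nacci c k j := by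
    have hI : Finset.Icc (i + 1 - k) i = Finset.Ioc (i - k) i := by
      ext x
      rw [Finset.mem_Icc, Finset.mem_Ioc]
      omega
    rw [hI]
    exact (Finset.add_sum_Ioc_eq_sum_Icc (f := fun j => nacci c k j) (show i - k ≤ i by omega)).symm
  rw [h3] at h
  rw [show i + 1 - k - 1 = i - k by omega]
  nlinarith

end Numbers

section Termination

def sumSq (A : Multiset ℕ) : ℕ := (A.map (fun x => x ^ 2)).sum

theorem sumSq_add (A B : Multiset ℕ) : sumSq (A + B) = sumSq A + sumSq B := by
  simp [sumSq]

theorem sumSq_le (A : Multiset ℕ) : sumSq A ≤ A.sum ^ 2 := by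
  induction A using Multiset.induction_on with
  | empty => simp [sumSq]
  | cons a A ih =>
    simp only [sumSq, Multiset.map_cons, Multiset.sum_cons] at ih ⊢
    nlinarith [Nat.zero_le (a * A.sum)]

/-- All elements smaller than the sum -/
theorem sumSq_lt (A : Multiset ℕ) (x : ℕ) (hx : x ∈ A) (h1 : 1 ≤ x) (h : x < A.sum) :
    sumSq A < A.sum ^ 2 := by
  obtain ⟨B, rfl⟩ := Multiset.exists_cons_of_mem hx
  have := sumSq_le B
  simp only [sumSq, Multiset.map_cons, Multiset.sum_cons] at this h ⊢
  have h2 : 1 ≤ x * B.sum := Nat.mul_pos h1 (by omega)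
  nlinarith

def meas (A : Multiset ℕ) : ℕ := A.sum ^ 2 - sumSq A

theorem meas_lt (A X Y : Multiset ℕ) (hX : X ≤ A) (hs : X.sum = Y.sum)
    (hq : sumSq X < sumSq Y) : meas (A - X + Y) < meas A := by
  obtain ⟨R, rfl⟩ := Multiset.le_iff_exists_add.mp hX
  rw [add_tsub_cancel_left]
  have h1 := sumSq_le (R + Y)
  unfold meas
  rw [sumSq_add] at h1 ⊢
  rw [sumSq_add]
  have : (R + Y).sum = (X + R).sum := by simp [hs, add_comm]
  rw [this] at h1 ⊢
  omega

theorem sum_block (c k : ℕ) (s : Finset ℕ) :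
    (nacciBlock c k s).sum = c * ∑ j ∈ s, nacci c k j := by
  rw [nacciBlock, Multiset.sum_bind, Finset.mul_sum]
  simp only [Multiset.sum_replicate, smul_eq_mul]
  rfl

theorem mem_block (c k : ℕ) (hc : 1 ≤ c) (s : Finset ℕ) (j : ℕ) (hj : j ∈ s) :
    nacci c k j ∈ nacciBlock c k s := by
  rw [nacciBlock, Multiset.mem_bind]
  exact ⟨j, hj, Multiset.mem_replicate.mpr ⟨by omega, rfl⟩⟩

theorem meas_merge (A X : Multiset ℕ) (x y : ℕ) (hX : X ≤ A) (hs : X.sum = y) (hx : x ∈ X)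
    (h1 : 1 ≤ x) (hxy : x < y) : meas (A - X + {y}) < meas A := by
  apply meas_lt A X _ hX (by simpa using hs)
  have := sumSq_lt X x hx h1 (by omega)
  simpa [sumSq, hs] using this

theorem move_meas (c k : ℕ) (hc : 1 ≤ c) (hk : 1 < k) (A B : Multiset ℕ)
    (h : CkMove c k A B) : meas B < meas A := by
  rcases h with ⟨i, hi, hle, rfl⟩ | ⟨i, h2, hi, hle, rfl⟩ | ⟨hle, rfl⟩ | ⟨i, h2, hi, hle, rfl⟩ |
    ⟨hle, rfl⟩ | ⟨i, hi, hle, rfl⟩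
  · refine meas_merge A _ (nacci c k i) _ hle ?_ ?_ (nacci_pos c k hc i (by omega))
      (nacci_lt_succ c k hc hk i (by omega))
    · rw [sum_block, nacci_high c k i hi]
    · exact mem_block c k hc _ _ (by simp)
  · refine meas_merge A _ (nacci c k i) _ hle ?_ ?_ (nacci_pos c k hc i (by omega))
      (nacci_lt_succ c k hc hk i (by omega))
    · rw [Multiset.sum_add, sum_block, nacci_low c k i (by omega) hi]
      have h3 : ∑ j ∈ Finset.Icc 1 i, nacci c k j
          = nacci c k 1 + ∑ j ∈ Finset.Icc 2 i, nacci c k j :=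
        (Finset.add_sum_Ioc_eq_sum_Icc (f := fun j => nacci c k j) (by omega)).symm
      rw [h3, nacci_one]
      simp
      ring
    · exact Multiset.mem_add.mpr (Or.inr (mem_block c k hc _ _ (by simp; omega)))
  · refine meas_merge A _ (nacci c k 1) _ hle ?_ ?_ (nacci_pos c k hc 1 (by omega))
      (nacci_lt_succ c k hc hk 1 (by omega))
    · rw [← nacci_geom c k 1 le_rfl (by omega)]
      rw [Multiset.sum_replicate, smul_eq_mul]
    · simp
  · refine meas_merge A _ (nacci c k i) _ hle ?_ ?_ (nacci_pos c k hc i (by omega))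
      (nacci_lt_succ c k hc hk i (by omega))
    · rw [← nacci_geom c k i (by omega) (by omega)]
      rw [Multiset.sum_replicate, smul_eq_mul]
    · simp
  · apply meas_lt A _ _ hle
    · have := nacci_mid c k
      simp [nacci_one]
      linarith
    · have h1 := nacci_mid c k
      have h2 := nacci_lt c k hc hk 1 (k+1) (by omega) (by omega)
      have h3 := nacci_lt_succ c k hc hk (k+1) (by omega)
      rw [nacci_one] at h2
      simp only [sumSq, Multiset.map_replicate, Multiset.sum_replicate, nacci_one,
        Multiset.insert_eq_cons, Multiset.map_cons, Multiset.map_singleton, Multiset.sum_cons,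
        Multiset.sum_singleton, smul_eq_mul]
      change nacci c k (k+1) < nacci c k (k+2) at h3
      generalize nacci c k (k+2) = y at *
      generalize nacci c k (k+1) = x at *
      have h4 : (c+1) * x^2 = (y+1) * x := by rw [← h1]; ring
      rw [h4]
      nlinarith
  · apply meas_lt A _ _ hle
    · have := nacci_top c k i hi
      simp
      linarith
    · have h1 := nacci_top c k i hi
      have h2 := nacci_lt c k hc hk (i-k-1) i (by omega) (by omega)
      simp only [sumSq, Multiset.map_replicate, Multiset.sum_replicate, Multiset.map_add,
        Multiset.map_singleton, Multiset.sum_add, Multiset.sum_singleton, smul_eq_mul]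
      generalize nacci c k (i+1) = y at *
      generalize nacci c k (i-k-1) = z at *
      generalize nacci c k i = x at *
      obtain ⟨d, rfl⟩ : ∃ d, x = z + d := ⟨x - z, by omega⟩
      obtain rfl : y = z + (c+1) * d := by nlinarith
      have hd : 1 ≤ d := by omega
      have : 1 ≤ c * (c+1) * d^2 := Nat.mul_pos (Nat.mul_pos hc (by omega)) (Nat.pow_pos hd)
      nlinarith

end Termination

section Positions

/-- `a` copies of `S_1`, `b` of `S_2`, `d` of `S_3`, `e` of `S_4`. -/
def Pos (c k a b d e : ℕ) : Multiset ℕ :=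
  Multiset.replicate a (nacci c k 1) + Multiset.replicate b (nacci c k 2)
    + Multiset.replicate d (nacci c k 3) + Multiset.replicate e (nacci c k 4)

theorem Pos_add (c k a b d e a' b' d' e' : ℕ) :
    Pos c k (a+a') (b+b') (d+d') (e+e') = Pos c k a b d e + Pos c k a' b' d' e' := by
  simp only [Pos, Multiset.replicate_add]
  abel

theorem count_Pos (c k : ℕ) (hc : 1 ≤ c) (hk : 1 < k) (a b d e j : ℕ) (hj : 1 ≤ j) :
    Multiset.count (nacci c k j) (Pos c k a b d e) =
      (if j = 1 then a else 0) + (if j = 2 then b else 0) + (if j = 3 then d else 0)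
        + (if j = 4 then e else 0) := by
  simp only [Pos, Multiset.count_add, Multiset.count_replicate]
  simp only [nacci_inj c k hc hk 1 j (by omega) hj, nacci_inj c k hc hk 2 j (by omega) hj,
    nacci_inj c k hc hk 3 j (by omega) hj, nacci_inj c k hc hk 4 j (by omega) hj]
  simp only [eq_comm]

theorem rep_count {m x : ℕ} {A : Multiset ℕ} (h : Multiset.replicate m x ≤ A) :
    m ≤ A.count x := Multiset.le_count_iff_replicate_le.mpr h

theorem rep_le_block (c k : ℕ) (s : Finset ℕ) (j : ℕ) (hj : j ∈ s) :
    Multiset.replicate c (nacci c k j) ≤ nacciBlock c k s := by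
  rw [nacciBlock]
  exact Multiset.le_bind (f := fun j => Multiset.replicate c (nacci c k j)) s.val hj

theorem block_count {c k : ℕ} {s : Finset ℕ} {A : Multiset ℕ} (h : nacciBlock c k s ≤ A)
    (j : ℕ) (hj : j ∈ s) : c ≤ A.count (nacci c k j) :=
  rep_count ((rep_le_block c k s j hj).trans h)

def dl (k : ℕ) : ℕ := if k = 2 then 1 else 0

theorem block22 (c k : ℕ) : nacciBlock c k (Finset.Icc 2 2) = Pos c k 0 c 0 0 := by
  simp [nacciBlock, Pos]

theorem block23 (c k : ℕ) : nacciBlock c k (Finset.Icc 2 3) = Pos c k 0 c c 0 := by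
  rw [show Finset.Icc 2 3 = {2, 3} by rfl]
  simp [nacciBlock, Pos]

theorem block13 (c k : ℕ) : nacciBlock c k (Finset.Icc 1 3) = Pos c k c c c 0 := by
  rw [show Finset.Icc 1 3 = {1, 2, 3} by rfl]
  simp [nacciBlock, Pos, add_assoc]

theorem rep1 (c k m : ℕ) : Multiset.replicate m (nacci c k 1) = Pos c k m 0 0 0 := by simp [Pos]
theorem rep2 (c k m : ℕ) : Multiset.replicate m (nacci c k 2) = Pos c k 0 m 0 0 := by simp [Pos]
theorem rep3 (c k m : ℕ) : Multiset.replicate m (nacci c k 3) = Pos c k 0 0 m 0 := by simp [Pos]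
theorem sing2 (c k : ℕ) : {nacci c k 2} = Pos c k 0 1 0 0 := by simp [Pos]
theorem sing3 (c k : ℕ) : {nacci c k 3} = Pos c k 0 0 1 0 := by simp [Pos]
theorem sing4 (c k : ℕ) : {nacci c k 4} = Pos c k 0 0 0 1 := by simp [Pos]
theorem pair41 (c k : ℕ) : {nacci c k 4, nacci c k 1} = Pos c k 1 0 0 1 := by
  simp only [Pos, Multiset.replicate_zero, Multiset.replicate_one, add_zero]
  rw [Multiset.insert_eq_cons, ← Multiset.singleton_add, add_comm]

theorem Pos_sub (c k a b d e a' b' d' e' : ℕ) (ha : a' ≤ a) (hb : b' ≤ b) (hd : d' ≤ d)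
    (he : e' ≤ e) : Pos c k a b d e - Pos c k a' b' d' e'
      = Pos c k (a-a') (b-b') (d-d') (e-e') := by
  conv_lhs => rw [show a = a' + (a-a') by omega, show b = b' + (b-b') by omega,
    show d = d' + (d-d') by omega, show e = e' + (e-e') by omega, Pos_add]
  rw [add_tsub_cancel_left]

theorem Pos_le (c k a b d e a' b' d' e' : ℕ) (ha : a' ≤ a) (hb : b' ≤ b) (hd : d' ≤ d)
    (he : e' ≤ e) : Pos c k a' b' d' e' ≤ Pos c k a b d e := by
  rw [show a = a' + (a-a') by omega, show b = b' + (b-b') by omega,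
    show d = d' + (d-d') by omega, show e = e' + (e-e') by omega, Pos_add]
  exact Multiset.le_add_right _ _

theorem E1 (c k a b d e : ℕ) (ha : c + 1 ≤ a) :
    CkMove c k (Pos c k a b d e) (Pos c k (a-(c+1)) (b+1) d e) := by
  refine Or.inr (Or.inr (Or.inl ⟨?_, ?_⟩))
  · rw [rep1]
    exact Pos_le _ _ _ _ _ _ _ _ _ _ ha (by omega) (by omega) (by omega)
  · rw [rep1, Pos_sub _ _ _ _ _ _ _ _ _ _ ha (by omega) (by omega) (by omega), sing2, ← Pos_add]
    rfl

theorem E2 (c k a b d e : ℕ) (hk : 1 < k) (ha : c + 1 ≤ a) (hb : c ≤ b) :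
    CkMove c k (Pos c k a b d e) (Pos c k (a-(c+1)) (b-c) (d+1) e) := by
  refine Or.inr (Or.inl ⟨2, le_rfl, by omega, ?_, ?_⟩)
  · rw [rep1, block22, ← Pos_add]
    exact Pos_le _ _ _ _ _ _ _ _ _ _ ha (by omega) (by omega) (by omega)
  · rw [rep1, block22, ← Pos_add,
      Pos_sub _ _ _ _ _ _ _ _ _ _ (by omega) (by omega) (by omega) (by omega), sing3, ← Pos_add]
    congr 1 <;> omega

theorem E3 (c k a b d e : ℕ) (hk : 1 < k) (hb : c + 1 ≤ b) :
    CkMove c k (Pos c k a b d e) (Pos c k a (b-(c+1)) (d+1) e) := by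
  refine Or.inr (Or.inr (Or.inr (Or.inl ⟨2, by omega, by omega, ?_, ?_⟩)))
  · rw [rep2]
    exact Pos_le _ _ _ _ _ _ _ _ _ _ (by omega) (by omega) (by omega) (by omega)
  · rw [rep2, Pos_sub _ _ _ _ _ _ _ _ _ _ (by omega) (by omega) (by omega) (by omega), sing3,
      ← Pos_add]
    rfl

theorem E4 (c k a b d e : ℕ) (hk : 1 < k) (hd : c + 1 ≤ d) :
    CkMove c k (Pos c k a b d e) (Pos c k (a + dl k) b (d-(c+1)) (e+1)) := by
  by_cases h2 : k = 2
  · subst h2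
    refine Or.inr (Or.inr (Or.inr (Or.inr (Or.inl ⟨?_, ?_⟩))))
    · rw [rep3]
      exact Pos_le _ _ _ _ _ _ _ _ _ _ (by omega) (by omega) (by omega) (by omega)
    · rw [rep3, Pos_sub _ _ _ _ _ _ _ _ _ _ (by omega) (by omega) (by omega) (by omega), pair41,
        ← Pos_add]
      rfl
  · refine Or.inr (Or.inr (Or.inr (Or.inl ⟨3, by omega, by omega, ?_, ?_⟩)))
    · rw [rep3]
      exact Pos_le _ _ _ _ _ _ _ _ _ _ (by omega) (by omega) (by omega) (by omega)
    · rw [rep3, Pos_sub _ _ _ _ _ _ _ _ _ _ (by omega) (by omega) (by omega) (by omega), sing4,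
        ← Pos_add, dl, if_neg h2]
      rfl

theorem E5 (c k a b d e : ℕ) (hk : 1 < k) (ha : c + 1 ≤ a) (hb : c ≤ b) (hd : c ≤ d) :
    CkMove c k (Pos c k a b d e) (Pos c k (a - (c+1) + dl k) (b-c) (d-c) (e+1)) := by
  by_cases h2 : k = 2
  · subst h2
    refine Or.inl ⟨3, le_rfl, ?_, ?_⟩
    · rw [show 3 - 2 = 1 by rfl, block13]
      exact Pos_le _ _ _ _ _ _ _ _ _ _ (by omega) (by omega) (by omega) (by omega)
    · rw [show 3 - 2 = 1 by rfl, block13,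
        Pos_sub _ _ _ _ _ _ _ _ _ _ (by omega) (by omega) (by omega) (by omega), sing4, ← Pos_add]
      simp only [dl, if_true]
      congr 1; omega
  · refine Or.inr (Or.inl ⟨3, by omega, by omega, ?_, ?_⟩)
    · rw [rep1, block23, ← Pos_add]
      exact Pos_le _ _ _ _ _ _ _ _ _ _ (by omega) (by omega) (by omega) (by omega)
    · rw [rep1, block23, ← Pos_add,
        Pos_sub _ _ _ _ _ _ _ _ _ _ (by omega) (by omega) (by omega) (by omega), sing4, ← Pos_add,
        dl, if_neg h2]
      congr 1 <;> omega

/-- Classification of the moves that are relevant. -/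
theorem master (c k a b d e : ℕ) (hc : 1 ≤ c) (hk : 1 < k) (he : e ≤ 1) (hde : e = 0 ∨ d = 0)
    (B : Multiset ℕ) (h : CkMove c k (Pos c k a b d e) B) :
    (c + 1 ≤ a ∧ B = Pos c k (a-(c+1)) (b+1) d e) ∨
    (c + 1 ≤ a ∧ c ≤ b ∧ B = Pos c k (a-(c+1)) (b-c) (d+1) e) ∨
    (c + 1 ≤ b ∧ B = Pos c k a (b-(c+1)) (d+1) e) ∨
    (c + 1 ≤ d ∧ B = Pos c k (a + dl k) b (d-(c+1)) (e+1)) ∨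
    (c ≤ b ∧ c ≤ d) := by
  rcases h with ⟨i, hi, hle, rfl⟩ | ⟨i, h2, hi, hle, rfl⟩ | ⟨hle, rfl⟩ | ⟨i, h2, hi, hle, rfl⟩ |
    ⟨hle, rfl⟩ | ⟨i, hi, hle, rfl⟩
  · have h1 := block_count hle i (by simp)
    have h2 := block_count hle (i-1) (by rw [Finset.mem_Icc]; omega)
    rw [count_Pos c k hc hk _ _ _ _ _ (by omega)] at h1 h2
    by_cases h3 : i = 3
    · subst h3
      simp at h1 h2
      omega
    · exfalso
      split_ifs at h1 h2 <;> omega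
  · have hle1 := (Multiset.le_add_right _ _).trans hle
    have hle2 := (Multiset.le_add_left _ _).trans hle
    have h1 := rep_count hle1
    have h3 := block_count hle2 i (by simp; omega)
    rw [count_Pos c k hc hk _ _ _ _ _ (by omega)] at h1 h3
    simp only [if_true, show ¬ (1 = 2) by omega, show ¬ (1 = 3) by omega, show ¬ (1 = 4) by omega,
      if_false, add_zero] at h1
    by_cases hi2 : i = 2
    · subst hi2
      simp at h3
      refine Or.inr (Or.inl ⟨h1, h3, ?_⟩)
      rw [rep1, block22, ← Pos_add,
        Pos_sub _ _ _ _ _ _ _ _ _ _ (by omega) (by omega) (by omega) (by omega), sing3, ← Pos_add]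
      congr 1 <;> omega
    · have h4 := block_count hle2 (i-1) (by rw [Finset.mem_Icc]; omega)
      rw [count_Pos c k hc hk _ _ _ _ _ (by omega)] at h4
      split_ifs at h3 h4 <;> omega
  · have h1 := rep_count hle
    rw [count_Pos c k hc hk _ _ _ _ _ (by omega)] at h1
    simp at h1
    refine Or.inl ⟨h1, ?_⟩
    rw [rep1, Pos_sub _ _ _ _ _ _ _ _ _ _ h1 (by omega) (by omega) (by omega), sing2, ← Pos_add]
    rfl
  · have h1 := rep_count hle
    rw [count_Pos c k hc hk _ _ _ _ _ (by omega)] at h1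
    by_cases hi2 : i = 2
    · subst hi2
      simp at h1
      refine Or.inr (Or.inr (Or.inl ⟨h1, ?_⟩))
      rw [rep2, Pos_sub _ _ _ _ _ _ _ _ _ _ (by omega) (by omega) (by omega) (by omega), sing3,
        ← Pos_add]
      rfl
    · by_cases hi3 : i = 3
      · subst hi3
        simp at h1
        refine Or.inr (Or.inr (Or.inr (Or.inl ⟨h1, ?_⟩)))
        rw [rep3, Pos_sub _ _ _ _ _ _ _ _ _ _ (by omega) (by omega) (by omega) (by omega), sing4,
          ← Pos_add, dl, if_neg (by omega)]
        rfl
      · exfalso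
        split_ifs at h1 <;> omega
  · have h1 := rep_count hle
    rw [count_Pos c k hc hk _ _ _ _ _ (by omega)] at h1
    by_cases h2 : k = 2
    · subst h2
      simp at h1
      refine Or.inr (Or.inr (Or.inr (Or.inl ⟨h1, ?_⟩)))
      rw [rep3, Pos_sub _ _ _ _ _ _ _ _ _ _ (by omega) (by omega) (by omega) (by omega), pair41,
        ← Pos_add]
      rfl
    · exfalso
      split_ifs at h1 <;> omega
  · have h1 := rep_count hle
    rw [count_Pos c k hc hk _ _ _ _ _ (by omega)] at h1
    exfalso
    split_ifs at h1 <;> omega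

/-- Forced moves. -/
theorem forced (c k a b d e : ℕ) (hc : 1 ≤ c) (hk : 1 < k) (he : e ≤ 1) (hde : e = 0 ∨ d = 0)
    (hb : b < c) (hd : d ≤ c) (B : Multiset ℕ) (h : CkMove c k (Pos c k a b d e) B) :
    c + 1 ≤ a ∧ B = Pos c k (a-(c+1)) (b+1) d e := by
  rcases master c k a b d e hc hk he hde B h with h | h | h | h | h
  · exact h
  all_goals omega

theorem dich (c k : ℕ) (hc : 1 ≤ c) (hk : 1 < k) (A : Multiset ℕ) :
    NWin (CkMove c k) A ∨ PWin (CkMove c k) A :=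
  dichotomy meas (move_meas c k hc hk) A

/-- If `(a,0,d+1)` is an N-position then `(a-(c+1),1,d+1)` is a P-position. -/
theorem forced_P (c k a b d e : ℕ) (hc : 1 ≤ c) (hk : 1 < k) (he : e ≤ 1) (hde : e = 0 ∨ d = 0)
    (hb : b < c) (hd : d ≤ c) (h : NWin (CkMove c k) (Pos c k a b d e)) :
    c + 1 ≤ a ∧ PWin (CkMove c k) (Pos c k (a-(c+1)) (b+1) d e) := by
  obtain ⟨B, hB, hP⟩ := h.ex
  obtain ⟨h1, rfl⟩ := forced c k a b d e hc hk he hde hb hd B hB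
  exact ⟨h1, hP⟩

theorem A_win (c k a d : ℕ) (hc : 1 ≤ c) (hk : 1 < k) (hd : d < c) :
    NWin (CkMove c k) (Pos c k a (c+1) d 0) := by
  have hE := E3 c k a (c+1) d 0 hk le_rfl
  rw [Nat.sub_self] at hE
  rcases dich c k hc hk (Pos c k a 0 (d+1) 0) with h | h
  · obtain ⟨ha, hP⟩ := forced_P c k a 0 (d+1) 0 hc hk (by omega) (by omega) (by omega) (by omega) h
    have hE2 := E2 c k a (c+1) d 0 hk ha (by omega)
    rw [show c + 1 - c = 0 + 1 by omega] at hE2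
    exact NWin.of hE2 hP
  · exact NWin.of hE h

/-- The key N-position. -/
theorem key (c k a : ℕ) (hc : 1 ≤ c) (hk : 1 < k) (ha : c + 1 ≤ a) (ha2 : c + 1 ≤ a - (c + 1)) :
    NWin (CkMove c k) (Pos c k a c c 0) := by
  have hX := E5 c k a c c 0 hk ha le_rfl le_rfl
  have hZ := E2 c k a c c 0 hk ha le_rfl
  rw [Nat.sub_self] at hX hZ
  rcases dich c k hc hk (Pos c k (a - (c+1) + dl k) 0 0 (0+1)) with h | h
  · refine NWin.of hZ ?_
    intro B hB
    rcases master c k _ _ _ _ hc hk (by omega) (by omega) B hB with h' | h' | h' | h' | h'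
    · obtain ⟨h1, rfl⟩ := h'
      have hY := (forced_P c k _ _ _ _ hc hk (by omega) (by omega) (by omega) (by omega) h).2
      have hW := E4 c k (a - (c+1) - (c+1)) (0+1) (c+1) 0 hk le_rfl
      rw [Nat.sub_self] at hW
      rw [show a - (c+1) + dl k - (c+1) = a - (c+1) - (c+1) + dl k by omega] at hY
      exact NWin.of hW hY
    · omega
    · omega
    · obtain ⟨h1, rfl⟩ := h'
      rw [Nat.sub_self]
      exact h
    · omega
  · exact NWin.of hX h

theorem step_forced (c k a b d p : ℕ) (hc : 1 ≤ c) (hk : 1 < k) (hb : b < c) (hd : d ≤ c)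
    (h : Outc (CkMove c k) p (Pos c k a (b+1) d 0)) :
    Outc (CkMove c k) (p+1) (Pos c k (a+(c+1)) b d 0) := by
  refine h.step ?_ ?_
  · intro hP
    have := E1 c k (a+(c+1)) b d 0 (by omega)
    rw [Nat.add_sub_cancel] at this
    exact NWin.of this hP
  · intro hN B hB
    obtain ⟨_, rfl⟩ := forced c k _ b d 0 hc hk (by omega) (by omega) hb hd B hB
    rw [Nat.add_sub_cancel]
    exact hN

theorem steps_forced (c k a d p : ℕ) (hc : 1 ≤ c) (hk : 1 < k) (hd : d ≤ c)
    (h : Outc (CkMove c k) p (Pos c k a c d 0)) (t : ℕ) (ht : t ≤ c) :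
    Outc (CkMove c k) (p+t) (Pos c k (a+t*(c+1)) (c-t) d 0) := by
  induction t with
  | zero => simpa using h
  | succ t ih =>
    have := ih (by omega)
    rw [show c - t = c - (t+1) + 1 by omega] at this
    have := step_forced c k _ _ d _ hc hk (by omega) hd this
    rw [show (t+1)*(c+1) = t*(c+1)+(c+1) by ring, ← add_assoc, ← add_assoc]
    exact this

theorem step_c (c k a d p : ℕ) (hc : 1 ≤ c) (hk : 1 < k) (hd : d < c)
    (h : Outc (CkMove c k) p (Pos c k a 0 (d+1) 0)) :
    Outc (CkMove c k) (p+1) (Pos c k (a+(c+1)) c d 0) := by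
  refine h.step ?_ ?_
  · intro hP
    have := E2 c k (a+(c+1)) c d 0 hk (by omega) le_rfl
    rw [Nat.add_sub_cancel, Nat.sub_self] at this
    exact NWin.of this hP
  · intro hN B hB
    rcases master c k _ _ _ _ hc hk (by omega) (by omega) B hB with h' | h' | h' | h' | h'
    · obtain ⟨h1, rfl⟩ := h'
      exact A_win c k _ d hc hk hd
    · obtain ⟨h1, h2, rfl⟩ := h'
      rw [Nat.add_sub_cancel, Nat.sub_self]
      exact hN
    all_goals omega

theorem chain (c k a : ℕ) (hc : 1 ≤ c) (hk : 1 < k) (ha : c + 1 ≤ a) (ha2 : c + 1 ≤ a - (c + 1))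
    (t : ℕ) (ht : t ≤ c) :
    Outc (CkMove c k) (t*(c+1)) (Pos c k (a+t*(c+1)^2) c (c-t) 0) := by
  induction t with
  | zero =>
    simp only [zero_mul, add_zero, Nat.sub_zero]
    exact ⟨fun _ => key c k a hc hk ha ha2, fun h => absurd (by simp) h⟩
  | succ t ih =>
    have h1 := steps_forced c k _ _ _ hc hk (by omega) (ih (by omega)) c le_rfl
    rw [Nat.sub_self, show c - t = c - (t+1) + 1 by omega] at h1
    have h2 := step_c c k _ _ _ hc hk (by omega) h1
    rw [show t * (c+1) + c + 1 = (t+1)*(c+1) by ring,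
      show a + t*(c+1)^2 + c*(c+1) + (c+1) = a + (t+1)*(c+1)^2 by ring] at h2
    exact h2

end Positions

/-- In the two-player `(c,k)`-nacci Zeckendorf game on `n` with `k > 1` and
`n ≥ (c+1)³ + (c+1)`: each of the first `c` turns admits exactly one legal move, and on
turn `c+1` — the earliest turn with more than one legal move, which belongs to the player
holding the winning strategy (Player 1 if `c` is even, Player 2 if `c` is odd) — there
exists a legal move for that player after which the opposing player has a winning
strategy for the remainder of the game.  (Move number `t`, counting from `0`, is
turn `t+1`, made by player `t % 2 + 1`.) -/
theorem ck_nacci_winner_can_lose_on_turn_c_plus_one (c k n : ℕ) (hc : 1 ≤ c) (hk : 1 < k)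
    (hn : (c + 1) ^ 3 + (c + 1) ≤ n) :
    PlayerWins (CkMove c k) 2 (if Even c then 1 else 2) n ∧
    c % 2 + 1 = (if Even c then 1 else 2) ∧
    ∃ path : ℕ → Multiset ℕ,
      path 0 = Multiset.replicate n 1 ∧
      (∀ t, t < c → CkMove c k (path t) (path (t + 1)) ∧
        ∀ B, CkMove c k (path t) B → B = path (t + 1)) ∧
      (∃ B₁ B₂, B₁ ≠ B₂ ∧ CkMove c k (path c) B₁ ∧ CkMove c k (path c) B₂) ∧
      (∃ B, CkMove c k (path c) B ∧
        AllianceWins (CkMove c k) 2 (fun q => q = (if Even c then 2 else 1)) (c + 1) B) := by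
  have hlow : c * (c+1) + c * (c+1)^2 + (c+1) + (c+1) ≤ n := by nlinarith
  obtain ⟨a, rfl⟩ : ∃ a, n = a + c * (c+1)^2 + c * (c+1) :=
    ⟨n - (c * (c+1)^2 + c * (c+1)), by omega⟩
  have hc1 := chain c k a hc hk (by omega) (by omega) c le_rfl
  have hc2 := steps_forced c k _ _ _ hc hk (by omega) hc1 c le_rfl
  rw [Nat.sub_self] at hc2
  have hev : Even (c * (c+1)) := Nat.even_mul_succ_self c
  have hstart : Multiset.replicate (a + c * (c+1)^2 + c * (c+1)) 1
      = Pos c k (a + c * (c+1)^2 + c * (c+1)) 0 0 0 := by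
    rw [← rep1, nacci_one]
  refine ⟨?_, ?_, fun t => Pos c k (a + c * (c+1)^2 + c * (c+1) - t * (c+1)) t 0 0, ?_, ?_, ?_, ?_⟩
  · unfold PlayerWins
    rw [hstart]
    by_cases h : Even c
    · rw [if_pos h]
      exact (hc2.1 (hev.add h)).alliance 0 1 rfl
    · rw [if_neg h]
      refine (hc2.2 ?_).alliance ⟨_, E1 c k _ _ _ _ (by omega)⟩ 0 2 rfl
      intro h'
      exact h ((Nat.even_add.mp h').mp hev)
  · split_ifs with h
    · rw [Nat.even_iff] at h; omega
    · rw [Nat.even_iff] at h; omega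
  · simp only [zero_mul, Nat.sub_zero]
    exact hstart.symm
  · intro t ht
    have h1 : (t+1) * (c+1) ≤ c * (c+1) := Nat.mul_le_mul_right _ ht
    have h2 : (t+1) * (c+1) = t*(c+1) + (c+1) := by ring
    simp only
    rw [h2, ← Nat.sub_sub]
    refine ⟨E1 c k _ _ _ _ (by omega), fun B hB => ?_⟩
    exact (forced c k _ t 0 0 hc hk (by omega) (by omega) ht (by omega) B hB).2
  · simp only [Nat.add_sub_cancel]
    refine ⟨_, _, ?_, E1 c k _ _ _ _ (by omega), E2 c k _ _ _ _ hk (by omega) le_rfl⟩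
    intro h
    have := congrArg (Multiset.count (nacci c k 3)) h
    rw [count_Pos c k hc hk _ _ _ _ _ (by omega), count_Pos c k hc hk _ _ _ _ _ (by omega)] at this
    simp at this
  · simp only [Nat.add_sub_cancel]
    refine ⟨_, E1 c k _ _ _ _ (by omega), ?_⟩
    refine (A_win c k _ 0 hc hk (by omega)).alliance _ _ ?_
    split_ifs with h
    · rw [Nat.even_iff] at h; omega
    · rw [Nat.even_iff] at h; omega
end

section
/- Let c be even, k > 1, and n >= (c+1)^3 + (c+1). Then Player 1 has a winning strategy in the two-player (c,k)-nacci Zeckendorf game on n, but there exists a legal move for Player 1 on turn c+1 after which Player 2 has a winning strategy for the remainder of the game. -/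
namespace Zk

theorem nacci_one (c k : ℕ) : nacci c k 1 = 1 := by
  rw [nacci]

theorem nacci_small (c k i : ℕ) (h : i + 1 ≤ k) :
    nacci c k (i + 2) = c * (∑ j ∈ Finset.range (i + 1), nacci c k (j + 1)) + 1 := by
  rw [nacci, if_pos h, Finset.sum_attach (Finset.range (i + 1)) (fun j => nacci c k (j + 1))]

theorem nacci_big (c k i : ℕ) (h : ¬ i + 1 ≤ k) :
    nacci c k (i + 2) = c * (∑ j ∈ Finset.Icc (i + 1 - k) (i + 1), nacci c k j) := by
  rw [nacci, if_neg h, Finset.sum_attach (Finset.Icc (i + 1 - k) (i + 1)) (fun j => nacci c k j)]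

theorem nacci_ge (c k i : ℕ) : c * nacci c k (i + 1) ≤ nacci c k (i + 2) := by
  by_cases h : i + 1 ≤ k
  · rw [nacci_small c k i h, Finset.sum_range_succ]
    nlinarith [Nat.zero_le (c * ∑ j ∈ Finset.range i, nacci c k (j + 1))]
  · rw [nacci_big c k i h]
    apply Nat.mul_le_mul_left
    exact Finset.single_le_sum (f := fun j => nacci c k j) (fun _ _ => Nat.zero_le _)
      (by simp)

theorem nacci_pos (c k : ℕ) (hc : 2 ≤ c) (i : ℕ) : 0 < nacci c k (i + 1) := by
  induction i with
  | zero => simp [nacci_one]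
  | succ i ih =>
    have := nacci_ge c k i
    nlinarith

theorem nacci_lt_succ (c k : ℕ) (hc : 2 ≤ c) (i : ℕ) : nacci c k (i + 1) < nacci c k (i + 2) := by
  have := nacci_ge c k i
  have := nacci_pos c k hc i
  nlinarith

theorem nacci_mono (c k : ℕ) (hc : 2 ≤ c) : StrictMono (fun i => nacci c k (i + 1)) :=
  strictMono_nat_of_lt_succ (nacci_lt_succ c k hc)

theorem nacci_lt (c k : ℕ) (hc : 2 ≤ c) {i j : ℕ} (hi : 1 ≤ i) (hij : i < j) :
    nacci c k i < nacci c k j := by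
  have := nacci_mono c k hc (a := i - 1) (b := j - 1) (by omega)
  simp only at this
  rwa [Nat.sub_add_cancel hi, Nat.sub_add_cancel (by omega)] at this

/-- Sum of squares. -/
def sq (A : Multiset ℕ) : ℕ := (A.map fun x => x * x).sum

theorem sq_add (A B : Multiset ℕ) : sq (A + B) = sq A + sq B := by simp [sq]

theorem sq_replicate (a x : ℕ) : sq (Multiset.replicate a x) = a * (x * x) := by
  simp [sq]

theorem sq_singleton (x : ℕ) : sq {x} = x * x := by simp [sq]

theorem sq_le_mul (A : Multiset ℕ) (s : ℕ) (h : ∀ x ∈ A, x ≤ s) : sq A ≤ s * A.sum := by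
  induction A using Multiset.induction with
  | empty => simp [sq]
  | cons a A ih =>
    have h1 := ih (fun x hx => h x (Multiset.mem_cons_of_mem hx))
    have h2 := h a (Multiset.mem_cons_self a A)
    simp only [sq, Multiset.map_cons, Multiset.sum_cons] at *
    nlinarith

theorem sq_le (A : Multiset ℕ) : sq A ≤ A.sum * A.sum :=
  sq_le_mul A _ (fun _ hx => Multiset.single_le_sum (fun _ _ => Nat.zero_le _) _ hx)

theorem sq_lt_merge (L : Multiset ℕ) (s : ℕ) (hs : 0 < s) (h : ∀ x ∈ L, x < s) (hsum : L.sum = s) :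
    sq L < sq {s} := by
  have := sq_le_mul L (s - 1) (fun x hx => by have := h x hx; omega)
  rw [sq_singleton]
  rw [hsum] at this
  obtain ⟨r, rfl⟩ : ∃ r, s = r + 1 := ⟨s - 1, by omega⟩
  simp only [Nat.add_sub_cancel] at this
  nlinarith

theorem block_sum (c k : ℕ) (s : Finset ℕ) :
    (nacciBlock c k s).sum = c * ∑ j ∈ s, nacci c k j := by
  rw [nacciBlock, Multiset.sum_bind]
  simp only [Multiset.sum_replicate, smul_eq_mul]
  rw [Finset.mul_sum]
  rfl

theorem mem_block (c k : ℕ) (s : Finset ℕ) (x : ℕ) (h : x ∈ nacciBlock c k s) :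
    ∃ j ∈ s, x = nacci c k j := by
  rw [nacciBlock, Multiset.mem_bind] at h
  obtain ⟨j, hj, hx⟩ := h
  exact ⟨j, hj, Multiset.eq_of_mem_replicate hx⟩

theorem repl_le_block (c k : ℕ) (s : Finset ℕ) (j : ℕ) (hj : j ∈ s) :
    Multiset.replicate c (nacci c k j) ≤ nacciBlock c k s :=
  Multiset.le_bind (f := fun j => Multiset.replicate c (nacci c k j)) s.val hj

/-- `L` may be replaced by `M` keeping the sum and raising the sum of squares. -/
def Good (L M : Multiset ℕ) : Prop := L.sum = M.sum ∧ sq L < sq M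

theorem good_apply {L M A B : Multiset ℕ} (h : Good L M) (hL : L ≤ A) (hB : B = A - L + M) :
    B.sum = A.sum ∧ sq A < sq B := by
  obtain ⟨R, rfl⟩ := Multiset.le_iff_exists_add.1 hL
  rw [add_tsub_cancel_left] at hB
  subst hB
  obtain ⟨h1, h2⟩ := h
  rw [sq_add, sq_add, Multiset.sum_add, Multiset.sum_add]
  omega

theorem nacci_mid (c k i : ℕ) (h1 : 1 ≤ i) (hi : i ≤ k) :
    nacci c k (i + 1) = (c + 1) * nacci c k i := by
  obtain ⟨i, rfl⟩ : ∃ r, i = r + 1 := ⟨i - 1, by omega⟩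
  rw [nacci_small c k i hi, Finset.sum_range_succ]
  rcases i with _ | i
  · simp [nacci_one]
  · rw [nacci_small c k i (by omega)]
    ring

theorem sum_shift (f : ℕ → ℕ) (i : ℕ) :
    ∑ j ∈ Finset.Icc 1 (i + 1), f j = ∑ j ∈ Finset.range (i + 1), f (j + 1) := by
  rw [Finset.range_eq_Ico, Finset.sum_Ico_add' f 0 (i + 1) 1]
  rfl

theorem nacci_top (c k : ℕ) (hk : 1 ≤ k) :
    nacci c k (k + 2) + 1 = (c + 1) * nacci c k (k + 1) := by
  obtain ⟨k, rfl⟩ : ∃ r, k = r + 1 := ⟨k - 1, by omega⟩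
  rw [nacci_big c (k + 1) (k + 1) (by omega)]
  rw [show k + 1 + 1 - (k + 1) = 1 by omega, sum_shift, Finset.sum_range_succ,
    nacci_small c (k + 1) k le_rfl]
  ring

theorem nacci_high (c k i : ℕ) (hi : k + 1 < i) :
    nacci c k (i + 1) + c * nacci c k (i - k - 1) = (c + 1) * nacci c k i := by
  obtain ⟨i, rfl⟩ : ∃ r, i = r + k + 2 := ⟨i - k - 2, by omega⟩
  rw [nacci_big c k (i + k + 1) (by omega), Finset.sum_Icc_succ_top (by omega),
    show i + k + 2 - k - 1 = i + 1 by omega, show i + k + 1 + 1 - k = i + 1 + 1 by omega,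
    nacci_big c k (i + k) (by omega), show i + k + 1 - k = i + 1 by omega]
  have := Finset.sum_Ioc_add_eq_sum_Icc (f := fun j => nacci c k j) (a := i + 1) (b := i + k + 1)
    (by omega)
  have h2 : Finset.Icc (i + 1 + 1) (i + k + 1) = Finset.Ioc (i + 1) (i + k + 1) := by
    ext x; simp only [Finset.mem_Icc, Finset.mem_Ioc]; omega
  rw [h2, ← this]
  ring

theorem move_measure (c k : ℕ) (hc : 2 ≤ c) (hk : 1 < k) (A B : Multiset ℕ) (h : CkMove c k A B) :
    B.sum = A.sum ∧ sq A < sq B := by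
  have pos : ∀ i, 1 ≤ i → 0 < nacci c k i := fun i hi => by
    have := nacci_pos c k hc (i - 1)
    rwa [Nat.sub_add_cancel hi] at this
  rcases h with ⟨i, hi, hL, hB⟩ | ⟨i, h2, hi, hL, hB⟩ | ⟨hL, hB⟩ | ⟨i, h1, hi, hL, hB⟩ | ⟨hL, hB⟩ |
    ⟨i, hi, hL, hB⟩
  · refine good_apply ?_ hL hB
    have hs : (nacciBlock c k (Finset.Icc (i - k) i)).sum = nacci c k (i + 1) := by
      rw [block_sum]
      obtain ⟨i, rfl⟩ : ∃ r, i = r + 1 := ⟨i - 1, by omega⟩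
      rw [nacci_big c k i (by omega)]
    refine ⟨by simpa using hs, sq_lt_merge _ _ (pos _ (by omega)) ?_ hs⟩
    intro x hx
    obtain ⟨j, hj, rfl⟩ := mem_block _ _ _ _ hx
    rw [Finset.mem_Icc] at hj
    exact nacci_lt c k hc (by omega) (by omega)
  · refine good_apply ?_ hL hB
    have hs : (Multiset.replicate (c + 1) (nacci c k 1) +
        nacciBlock c k (Finset.Icc 2 i)).sum = nacci c k (i + 1) := by
      rw [Multiset.sum_add, block_sum]
      obtain ⟨i, rfl⟩ : ∃ r, i = r + 1 := ⟨i - 1, by omega⟩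
      have := Finset.sum_Ioc_add_eq_sum_Icc (f := fun j => nacci c k j) (a := 1) (b := i + 1)
        (by omega)
      have h3 : Finset.Icc 2 (i + 1) = Finset.Ioc 1 (i + 1) := by
        ext x; simp; omega
      rw [nacci_small c k i (by omega), ← sum_shift (fun j => nacci c k j), h3, ← this]
      simp [nacci_one]
      ring
    refine ⟨by simpa using hs, sq_lt_merge _ _ (pos _ (by omega)) ?_ hs⟩
    intro x hx
    rcases Multiset.mem_add.1 hx with hx | hx
    · rw [Multiset.eq_of_mem_replicate hx]
      exact nacci_lt c k hc (by omega) (by omega)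
    obtain ⟨j, hj, rfl⟩ := mem_block _ _ _ _ hx
    rw [Finset.mem_Icc] at hj
    exact nacci_lt c k hc (by omega) (by omega)
  · refine good_apply ?_ hL hB
    have := nacci_mid c k 1 le_rfl (by omega)
    refine ⟨by simp [this]; ring, sq_lt_merge _ _ (pos _ (by omega)) ?_ (by simp [this]; ring)⟩
    intro x hx
    rw [Multiset.eq_of_mem_replicate hx]
    exact nacci_lt c k hc (by omega) (by omega)
  · refine good_apply ?_ hL hB
    have := nacci_mid c k i (by omega) (by omega)
    refine ⟨by simp [this]; ring, sq_lt_merge _ _ (pos _ (by omega)) ?_ (by simp [this]; ring)⟩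
    intro x hx
    rw [Multiset.eq_of_mem_replicate hx]
    exact nacci_lt c k hc (by omega) (by omega)
  · refine good_apply ?_ hL hB
    have h := nacci_top c k (by omega)
    have hp := pos (k + 1) (by omega)
    refine ⟨by simp [nacci_one, h]; ring, ?_⟩
    rw [sq_replicate]
    have : sq {nacci c k (k + 2), nacci c k 1} = nacci c k (k + 2) * nacci c k (k + 2) + 1 := by
      simp [sq, nacci_one]
    rw [this]
    generalize nacci c k (k + 2) = x at *
    generalize nacci c k (k + 1) = z at *
    have hcz : 2 ≤ c * z := by nlinarith
    obtain ⟨w, hw⟩ := Nat.exists_eq_add_of_le hcz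
    have hx : x = 2 + w + z - 1 := by
      have : (c + 1) * z = c * z + z := by ring
      omega
    have hx2 : x = 1 + w + z := by omega
    have e1 : (c + 1) * (z * z) = (x + 1) * z := by rw [h]; ring
    rw [e1, hx2]
    nlinarith
  · refine good_apply ?_ hL hB
    have h := nacci_high c k i hi
    have hlt := nacci_lt c k hc (i := i) (j := i + 1) (by omega) (by omega)
    refine ⟨by simp [h]; ring, ?_⟩
    rw [sq_replicate, sq_add, sq_singleton, sq_replicate]
    generalize nacci c k (i + 1) = x at *
    generalize nacci c k i = z at *
    generalize nacci c k (i - k - 1) = y at *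
    zify at *
    have hx : x = (c + 1) * z - c * (y : ℤ) := by linarith
    have hd : (0 : ℤ) < c * ((z : ℤ) - y) := by nlinarith
    have hd2 : (0 : ℤ) < (z : ℤ) - y := by
      by_contra hcon
      push Not at hcon
      nlinarith
    rw [hx]
    nlinarith [mul_pos hd hd, mul_pos hd hd2]

/-- Positions won by the player to move. -/
inductive NPos (Move : Multiset ℕ → Multiset ℕ → Prop) : Multiset ℕ → Prop
  | mk (A B : Multiset ℕ) (h : Move A B) (hall : ∀ C, Move B C → NPos Move C) : NPos Move A

/-- Positions lost by the player to move. -/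
def PPos (Move : Multiset ℕ → Multiset ℕ → Prop) (A : Multiset ℕ) : Prop :=
  ∀ C, Move A C → NPos Move C

theorem determined (c k : ℕ) (hc : 2 ≤ c) (hk : 1 < k) (A : Multiset ℕ) :
    NPos (CkMove c k) A ∨ PPos (CkMove c k) A := by
  induction h : A.sum * A.sum - sq A using Nat.strong_induction_on generalizing A with
  | _ d ih =>
    subst h
    by_cases hP : PPos (CkMove c k) A
    · exact Or.inr hP
    · left
      unfold PPos at hP
      push Not at hP
      obtain ⟨C, hC, hN⟩ := hP
      have hm := move_measure c k hc hk A C hC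
      have h2 := sq_le C
      rw [hm.1] at h2
      rcases ih (C.sum * C.sum - sq C) (by rw [hm.1]; omega) C rfl with h | h
      · exact absurd h hN
      · exact .mk A C hC h

theorem npos_wins (Move : Multiset ℕ → Multiset ℕ → Prop) (m : ℕ) (A : Multiset ℕ)
    (h : NPos Move A) : ∀ t, t % 2 + 1 = m → AllianceWins Move 2 (fun q => q = m) t A := by
  induction h with
  | mk A B h _ ih =>
    intro t ht
    by_cases hT : Terminal Move B
    · exact .endMove t A B ht h hT
    · unfold Terminal at hT
      push Not at hT
      refine .contMove t A B ht h (.oppMove _ _ (by omega) hT ?_)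
      intro C hC
      exact ih C hC _ (by omega)

/-- `m` copies of `S₁`, `a` of `S₂`, `b` of `S₃`, `d` of `S₄`. -/
def pos (c k m a b d : ℕ) : Multiset ℕ :=
  Multiset.replicate m (nacci c k 1) + Multiset.replicate a (nacci c k 2) +
  Multiset.replicate b (nacci c k 3) + Multiset.replicate d (nacci c k 4)

theorem pos_add (c k m a b d m' a' b' d' : ℕ) :
    pos c k m a b d + pos c k m' a' b' d' = pos c k (m + m') (a + a') (b + b') (d + d') := by
  simp only [pos, Multiset.replicate_add]
  abel

theorem counts (c k m a b d : ℕ) (hc : 2 ≤ c) :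
    (pos c k m a b d).count (nacci c k 1) = m ∧ (pos c k m a b d).count (nacci c k 2) = a ∧
    (pos c k m a b d).count (nacci c k 3) = b ∧ (pos c k m a b d).count (nacci c k 4) = d ∧
    ∀ i, 5 ≤ i → (pos c k m a b d).count (nacci c k i) = 0 := by
  have h12 := nacci_lt c k hc (i := 1) (j := 2) (by omega) (by omega)
  have h23 := nacci_lt c k hc (i := 2) (j := 3) (by omega) (by omega)
  have h34 := nacci_lt c k hc (i := 3) (j := 4) (by omega) (by omega)
  simp only [pos, Multiset.count_add, Multiset.count_replicate]
  refine ⟨?_, ?_, ?_, ?_, ?_⟩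
  · rw [if_pos trivial, if_neg (by omega), if_neg (by omega), if_neg (by omega)]; rfl
  · rw [if_pos trivial, if_neg (by omega), if_neg (by omega), if_neg (by omega)]; omega
  · rw [if_pos trivial, if_neg (by omega), if_neg (by omega), if_neg (by omega)]; omega
  · rw [if_pos trivial, if_neg (by omega), if_neg (by omega), if_neg (by omega)]; omega
  · intro i hi
    have h45 := nacci_lt c k hc (i := 4) (j := i) (by omega) (by omega)
    rw [if_neg (by omega), if_neg (by omega), if_neg (by omega), if_neg (by omega)]

theorem pos_le (c k m a b d m' a' b' d' : ℕ) (hc : 2 ≤ c)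
    (h : pos c k m' a' b' d' ≤ pos c k m a b d) : m' ≤ m ∧ a' ≤ a ∧ b' ≤ b ∧ d' ≤ d := by
  obtain ⟨h1, h2, h3, h4, -⟩ := counts c k m a b d hc
  obtain ⟨g1, g2, g3, g4, -⟩ := counts c k m' a' b' d' hc
  have := fun x => Multiset.count_le_of_le x h
  refine ⟨?_, ?_, ?_, ?_⟩
  · rw [← h1, ← g1]; exact this _
  · rw [← h2, ← g2]; exact this _
  · rw [← h3, ← g3]; exact this _
  · rw [← h4, ← g4]; exact this _

theorem big_absurd (c k m a b d r i : ℕ) (hc : 2 ≤ c) (hd : d ≤ 1) (hr : c ≤ r) (hi : 4 ≤ i)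
    (h : Multiset.replicate r (nacci c k i) ≤ pos c k m a b d) : False := by
  rw [← Multiset.le_count_iff_replicate_le] at h
  obtain ⟨-, -, -, h4, h5⟩ := counts c k m a b d hc
  rcases Nat.lt_or_ge i 5 with h' | h'
  · obtain rfl : i = 4 := by omega
    omega
  · rw [h5 i h'] at h
    omega

theorem r1 (c k r : ℕ) : Multiset.replicate r (nacci c k 1) = pos c k r 0 0 0 := by simp [pos]
theorem r2 (c k r : ℕ) : Multiset.replicate r (nacci c k 2) = pos c k 0 r 0 0 := by simp [pos]
theorem r3 (c k r : ℕ) : Multiset.replicate r (nacci c k 3) = pos c k 0 0 r 0 := by simp [pos]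
theorem s2 (c k : ℕ) : {nacci c k 2} = pos c k 0 1 0 0 := by simp [pos]
theorem s3 (c k : ℕ) : {nacci c k 3} = pos c k 0 0 1 0 := by simp [pos]
theorem s4 (c k : ℕ) : {nacci c k 4} = pos c k 0 0 0 1 := by simp [pos]
theorem s41 (c k : ℕ) : {nacci c k 4, nacci c k 1} = pos c k 1 0 0 1 := by
  simp only [pos, Multiset.replicate_one, Multiset.replicate_zero, add_zero]
  rw [Multiset.insert_eq_cons, ← Multiset.singleton_add, add_comm]
theorem b22 (c k : ℕ) : nacciBlock c k (Finset.Icc 2 2) = pos c k 0 c 0 0 := by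
  simp [nacciBlock, pos]
theorem b23 (c k : ℕ) : nacciBlock c k (Finset.Icc 2 3) = pos c k 0 c c 0 := by
  have : Finset.Icc 2 3 = {2, 3} := by decide
  simp [nacciBlock, pos, this]
theorem b13 (c k : ℕ) : nacciBlock c k (Finset.Icc 1 3) = pos c k c c c 0 := by
  have : Finset.Icc 1 3 = {1, 2, 3} := by decide
  simp [nacciBlock, pos, this, add_assoc]

theorem pos_sub (c k m a b d m' a' b' d' x y z w : ℕ) :
    pos c k (m + m') (a + a') (b + b') (d + d') - pos c k m' a' b' d' + pos c k x y z w =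
    pos c k (m + x) (a + y) (b + z) (d + w) := by
  rw [← pos_add, add_tsub_cancel_right, pos_add]

theorem le_add (c k m a b d m' a' b' d' : ℕ) :
    pos c k m' a' b' d' ≤ pos c k (m + m') (a + a') (b + b') (d + d') := by
  rw [← pos_add]; exact Multiset.le_add_left _ _

/-- Is the extra `S₁` returned? -/
def ee (k : ℕ) : ℕ := if k = 2 then 1 else 0

theorem mvA (c k m a b d : ℕ) :
    CkMove c k (pos c k (m + (c + 1)) a b d) (pos c k m (a + 1) b d) := by
  right; right; left
  rw [r1, s2]
  exact ⟨le_add c k m a b d (c + 1) 0 0 0, (pos_sub c k m a b d (c + 1) 0 0 0 0 1 0 0).symm⟩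

theorem mvB (c k m a b d : ℕ) (hk : 1 < k) :
    CkMove c k (pos c k (m + (c + 1)) (a + c) b d) (pos c k m a (b + 1) d) := by
  right; left
  refine ⟨2, le_rfl, hk, ?_⟩
  rw [r1, s3, b22, pos_add, add_zero, zero_add, zero_add]
  exact ⟨le_add c k m a b d (c + 1) c 0 0, (pos_sub c k m a b d (c + 1) c 0 0 0 0 1 0).symm⟩

theorem mvC (c k m a b d : ℕ) (hk : 1 < k) :
    CkMove c k (pos c k m (a + (c + 1)) b d) (pos c k m a (b + 1) d) := by
  right; right; right; left
  refine ⟨2, by omega, by omega, ?_⟩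
  rw [r2, s3]
  exact ⟨le_add c k m a b d 0 (c + 1) 0 0, (pos_sub c k m a b d 0 (c + 1) 0 0 0 0 1 0).symm⟩

theorem mvD (c k m a b d : ℕ) (hk : 1 < k) :
    CkMove c k (pos c k (m + (c + 1)) (a + c) (b + c) d) (pos c k (m + ee k) a b (d + 1)) := by
  by_cases h : k = 2
  · subst h
    left
    refine ⟨3, le_rfl, ?_⟩
    rw [show 3 - 2 = 1 from rfl, show 3 + 1 = 4 from rfl, b13, s4]
    rw [show m + (c + 1) = m + 1 + c by ring]
    exact ⟨le_add c 2 (m + 1) a b d c c c 0,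
      (pos_sub c 2 (m + 1) a b d c c c 0 0 0 0 1).symm⟩
  · right; left
    refine ⟨3, by omega, by omega, ?_⟩
    rw [r1, b23, show 3 + 1 = 4 from rfl, s4, pos_add, add_zero, zero_add, zero_add, ee, if_neg h]
    exact ⟨le_add c k m a b d (c + 1) c c 0, (pos_sub c k m a b d (c + 1) c c 0 0 0 0 1).symm⟩

theorem mvE (c k m a b d : ℕ) (hk : 1 < k) :
    CkMove c k (pos c k m a (b + (c + 1)) d) (pos c k (m + ee k) a b (d + 1)) := by
  by_cases h : k = 2
  · subst h
    right; right; right; right; left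
    rw [show 2 + 1 = 3 from rfl, show 2 + 2 = 4 from rfl, r3, s41]
    exact ⟨le_add c 2 m a b d 0 0 (c + 1) 0,
      (pos_sub c 2 m a b d 0 0 (c + 1) 0 1 0 0 1).symm⟩
  · right; right; right; left
    refine ⟨3, by omega, by omega, ?_⟩
    rw [r3, show 3 + 1 = 4 from rfl, s4, ee, if_neg h]
    exact ⟨le_add c k m a b d 0 0 (c + 1) 0,
      (pos_sub c k m a b d 0 0 (c + 1) 0 0 0 0 1).symm⟩

/-- Enumeration of the legal moves. -/
theorem enum (c k m a b d : ℕ) (hc : 2 ≤ c) (hk : 1 < k) (hd : d ≤ 1) (hab : a < c ∨ b < c)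
    (B : Multiset ℕ) (h : CkMove c k (pos c k m a b d) B) :
    (∃ m', m = m' + (c + 1) ∧ B = pos c k m' (a + 1) b d) ∨
    (∃ m' a', m = m' + (c + 1) ∧ a = a' + c ∧ B = pos c k m' a' (b + 1) d) ∨
    (∃ a', a = a' + (c + 1) ∧ B = pos c k m a' (b + 1) d) ∨
    (∃ b', b = b' + (c + 1) ∧ B = pos c k (m + ee k) a b' (d + 1)) := by
  rcases h with ⟨i, hi, hL, hB⟩ | ⟨i, h2, hi, hL, hB⟩ | ⟨hL, hB⟩ | ⟨i, h1, hi, hL, hB⟩ | ⟨hL, hB⟩ |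
    ⟨i, hi, hL, hB⟩
  · exfalso
    by_cases h4 : 4 ≤ i
    · exact big_absurd c k m a b d c i hc hd le_rfl h4
        ((repl_le_block c k _ i (by simp)).trans hL)
    · obtain rfl : i = 3 := by omega
      obtain rfl : k = 2 := by omega
      rw [show 3 - 2 = 1 from rfl, b13] at hL
      have := pos_le _ _ _ _ _ _ _ _ _ _ hc hL
      omega
  · by_cases h4 : 4 ≤ i
    · exfalso
      exact big_absurd c k m a b d c i hc hd le_rfl h4
        ((repl_le_block c k _ i (by simp; omega)).trans ((Multiset.le_add_left _ _).trans hL))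
    · rcases (show i = 2 ∨ i = 3 by omega) with rfl | rfl
      · rw [r1, b22, s3, pos_add] at hB
        rw [r1, b22, pos_add] at hL
        have := pos_le _ _ _ _ _ _ _ _ _ _ hc hL
        obtain ⟨m, rfl⟩ := Nat.exists_eq_add_of_le' (show c + 1 ≤ m by omega)
        obtain ⟨a, rfl⟩ := Nat.exists_eq_add_of_le' (show c ≤ a by omega)
        right; left
        refine ⟨m, a, rfl, rfl, ?_⟩
        rw [hB, add_zero, zero_add, zero_add]
        exact pos_sub c k m a b d (c + 1) c 0 0 0 0 1 0
      · exfalso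
        rw [r1, b23, pos_add] at hL
        have := pos_le _ _ _ _ _ _ _ _ _ _ hc hL
        omega
  · rw [r1, s2] at hB
    rw [r1] at hL
    have := pos_le _ _ _ _ _ _ _ _ _ _ hc hL
    obtain ⟨m, rfl⟩ := Nat.exists_eq_add_of_le' (show c + 1 ≤ m by omega)
    left
    refine ⟨m, rfl, ?_⟩
    rw [hB]
    exact pos_sub c k m a b d (c + 1) 0 0 0 0 1 0 0
  · by_cases h4 : 4 ≤ i
    · exact (big_absurd c k m a b d (c + 1) i hc hd (by omega) h4 hL).elim
    · rcases (show i = 2 ∨ i = 3 by omega) with rfl | rfl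
      · rw [r2, s3] at hB
        rw [r2] at hL
        have := pos_le _ _ _ _ _ _ _ _ _ _ hc hL
        obtain ⟨a, rfl⟩ := Nat.exists_eq_add_of_le' (show c + 1 ≤ a by omega)
        right; right; left
        refine ⟨a, rfl, ?_⟩
        rw [hB]
        exact pos_sub c k m a b d 0 (c + 1) 0 0 0 0 1 0
      · rw [r3, show 3 + 1 = 4 from rfl, s4] at hB
        rw [r3] at hL
        have := pos_le _ _ _ _ _ _ _ _ _ _ hc hL
        obtain ⟨b, rfl⟩ := Nat.exists_eq_add_of_le' (show c + 1 ≤ b by omega)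
        right; right; right
        refine ⟨b, rfl, ?_⟩
        rw [hB, ee, if_neg (by omega)]
        exact pos_sub c k m a b d 0 0 (c + 1) 0 0 0 0 1
  · by_cases h : k = 2
    · subst h
      rw [show 2 + 1 = 3 from rfl, show 2 + 2 = 4 from rfl, r3, s41] at hB
      rw [show 2 + 1 = 3 from rfl, r3] at hL
      have := pos_le _ _ _ _ _ _ _ _ _ _ hc hL
      obtain ⟨b, rfl⟩ := Nat.exists_eq_add_of_le' (show c + 1 ≤ b by omega)
      right; right; right
      refine ⟨b, rfl, ?_⟩
      rw [hB]
      exact pos_sub c 2 m a b d 0 0 (c + 1) 0 1 0 0 1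
    · exact (big_absurd c k m a b d (c + 1) (k + 1) hc hd (by omega) (by omega) hL).elim
  · exact (big_absurd c k m a b d (c + 1) i hc hd (by omega) (by omega) hL).elim

/-- The corner position is won by the player to move. -/
theorem corner (c k s : ℕ) (hc : 2 ≤ c) (hk : 1 < k) :
    NPos (CkMove c k) (pos c k (s + (c + 1) + (c + 1)) c c 0) := by
  have hD := mvD c k (s + (c + 1)) 0 0 0 hk
  rw [zero_add] at hD
  rcases determined c k hc hk (pos c k (s + (c + 1) + ee k) 0 0 (0 + 1)) with hN | hP
  · -- the only option of `Q` is lost for the mover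
    have hQ' : PPos (CkMove c k) (pos c k (s + ee k) 1 0 1) := by
      obtain ⟨_, B, hB, hall⟩ := hN
      rcases enum c k _ _ _ _ hc hk le_rfl (Or.inl (by omega)) B hB with
        ⟨m', hm, rfl⟩ | ⟨m', a', _, h, _⟩ | ⟨a', h, _⟩ | ⟨b', h, _⟩
      · obtain rfl : m' = s + ee k := by omega
        exact hall
      all_goals omega
    have hB := mvB c k (s + (c + 1)) 0 c 0 hk
    rw [zero_add] at hB
    refine .mk _ _ hB ?_
    intro C hC
    rcases enum c k _ _ _ _ hc hk (by omega) (Or.inl (by omega)) C hC with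
        ⟨m', hm, rfl⟩ | ⟨m', a', _, h, _⟩ | ⟨a', h, _⟩ | ⟨b', h, rfl⟩
    · obtain rfl : m' = s := by omega
      have hE := mvE c k m' (0 + 1) 0 0 hk
      rw [zero_add, zero_add (c + 1)] at hE
      exact .mk _ _ hE hQ'
    · omega
    · omega
    · obtain rfl : b' = 0 := by omega
      exact hN
  · exact .mk _ _ hD hP

/-- Number of ones left. -/
def ones (c r x y : ℕ) : ℕ := r + (c + 1) * (x + y * (c + 1))

theorem ones_x (c r x y : ℕ) : ones c r (x + 1) y = ones c r x y + (c + 1) := by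
  unfold ones; ring

theorem ones_y (c r y : ℕ) : ones c r 0 (y + 1) = ones c r c y + (c + 1) := by
  unfold ones; ring

/-- The statement about a grid position. -/
def Grid (c k r x y a b : ℕ) : Prop :=
  (Even (x + y) → NPos (CkMove c k) (pos c k (ones c r x y) a b 0)) ∧
  (¬ Even (x + y) → PPos (CkMove c k) (pos c k (ones c r x y) a b 0))

theorem vpos (c k r y b : ℕ) (hc : 2 ≤ c) (hk : 1 < k)
    (h0 : Grid c k r c y 0 (b + 1)) (h1 : Grid c k r (c - 1) y 1 (b + 1)) :
    NPos (CkMove c k) (pos c k (ones c r c y) (c + 1) b 0) := by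
  by_cases h : Even (c + y)
  · have hP := h1.2 (by grind)
    have hB := mvB c k (ones c r (c - 1) y) 1 b 0 hk
    rw [← ones_x, Nat.sub_add_cancel (by omega), add_comm 1 c] at hB
    exact .mk _ _ hB hP
  · have hC := mvC c k (ones c r c y) 0 b 0 hk
    rw [zero_add] at hC
    exact .mk _ _ hC (h0.2 h)

theorem grid (c k s : ℕ) (hc : 2 ≤ c) (hce : Even c) (hk : 1 < k) :
    ∀ y x a b, a + x = c → b + y = c → Grid c k (s + (c + 1) + (c + 1)) x y a b := by
  intro y
  induction y with
  | zero =>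
    intro x
    induction x with
    | zero =>
      intro a b ha hb
      obtain rfl : a = c := by omega
      obtain rfl : b = a := by omega
      refine ⟨fun _ => ?_, fun h => absurd (by simp) h⟩
      simpa [ones] using corner b k s hc hk
    | succ x ih =>
      intro a b ha hb
      have ih := ih (a + 1) b (by omega) hb
      refine ⟨fun h => ?_, fun h => ?_⟩
      · rw [ones_x]
        exact .mk _ _ (mvA c k _ a b 0) (ih.2 (by grind))
      · rw [ones_x]
        intro C hC
        rcases enum c k _ _ _ _ hc hk (by omega) (Or.inl (by omega)) C hC with
          ⟨m', hm, rfl⟩ | ⟨m', a', _, h, _⟩ | ⟨a', h, _⟩ | ⟨b', h, rfl⟩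
        · obtain rfl := Nat.add_right_cancel hm
          exact ih.1 (by grind)
        all_goals omega
  | succ y ihy =>
    intro x
    induction x with
    | zero =>
      intro a b ha hb
      obtain rfl : a = c := by omega
      have g0 := ihy a 0 (b + 1) (by omega) (by omega)
      have g1 := ihy (a - 1) 1 (b + 1) (by omega) (by omega)
      have hV := vpos a k _ y b hc hk g0 g1
      refine ⟨fun h => ?_, fun h => ?_⟩
      · rw [ones_y]
        have hB := mvB a k (ones a (s + (a + 1) + (a + 1)) a y) 0 b 0 hk
        rw [zero_add] at hB
        exact .mk _ _ hB (g0.2 (by grind))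
      · rw [ones_y]
        intro C hC
        rcases enum a k _ _ _ _ hc hk (by omega) (Or.inr (by omega)) C hC with
          ⟨m', hm, rfl⟩ | ⟨m', a', hm, h, rfl⟩ | ⟨a', h, _⟩ | ⟨b', h, rfl⟩
        · obtain rfl := Nat.add_right_cancel hm
          exact hV
        · obtain rfl := Nat.add_right_cancel hm
          obtain rfl : a' = 0 := by omega
          exact g0.1 (by grind)
        all_goals omega
    | succ x ih =>
      intro a b ha hb
      have ih := ih (a + 1) b (by omega) hb
      refine ⟨fun h => ?_, fun h => ?_⟩
      · rw [ones_x]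
        exact .mk _ _ (mvA c k _ a b 0) (ih.2 (by grind))
      · rw [ones_x]
        intro C hC
        rcases enum c k _ _ _ _ hc hk (by omega) (Or.inl (by omega)) C hC with
          ⟨m', hm, rfl⟩ | ⟨m', a', _, h, _⟩ | ⟨a', h, _⟩ | ⟨b', h, rfl⟩
        · obtain rfl := Nat.add_right_cancel hm
          exact ih.1 (by grind)
        all_goals omega

end Zk

/-- Let `c` be even, `k > 1`, and `n ≥ (c+1)³ + (c+1)`.  Then Player 1 has a winning
strategy in the two-player `(c,k)`-nacci Zeckendorf game on `n`, but there exists a legal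
move for Player 1 on turn `c+1` (i.e., from the position reached after the first `c`
moves) after which Player 2 has a winning strategy for the remainder of the game. -/
theorem even_c_player_one_wins_but_can_err (c k n : ℕ) (hc : 1 ≤ c) (hceven : Even c)
    (hk : 1 < k) (hn : (c + 1) ^ 3 + (c + 1) ≤ n) :
    PlayerWins (CkMove c k) 2 1 n ∧
    ∃ path : ℕ → Multiset ℕ,
      path 0 = Multiset.replicate n 1 ∧
      (∀ t, t < c → CkMove c k (path t) (path (t + 1))) ∧
      (∃ B, CkMove c k (path c) B ∧
        AllianceWins (CkMove c k) 2 (fun q => q = 2) (c + 1) B) := by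
  have hc2 : 2 ≤ c := by
    obtain ⟨r, rfl⟩ := hceven
    omega
  obtain ⟨s, rfl⟩ := Nat.exists_eq_add_of_le' hn
  set r := s + (c + 1) + (c + 1) with hr
  have hones : s + ((c + 1) ^ 3 + (c + 1)) = Zk.ones c r c c := by
    rw [hr]; unfold Zk.ones; ring
  have hstart : Multiset.replicate (s + ((c + 1) ^ 3 + (c + 1))) 1 =
      Zk.pos c k (Zk.ones c r c c) 0 0 0 := by
    rw [← Zk.r1, Zk.nacci_one, hones]
  have G := Zk.grid c k s hc2 hceven hk
  constructor
  · unfold PlayerWins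
    rw [hstart]
    exact Zk.npos_wins _ 1 _ ((G c c 0 0 (by omega) (by omega)).1 (by simp)) 0 rfl
  · refine ⟨fun t => Zk.pos c k (Zk.ones c r (c - t) c) t 0 0, ?_, ?_, ?_⟩
    · rw [hstart]; rfl
    · intro t ht
      have h := Zk.mvA c k (Zk.ones c r (c - (t + 1)) c) t 0 0
      rw [← Zk.ones_x, show c - (t + 1) + 1 = c - t by omega] at h
      exact h
    · obtain ⟨y, hy⟩ : ∃ y, c = y + 1 := ⟨c - 1, by omega⟩
      refine ⟨Zk.pos c k (Zk.ones c r c y) (c + 1) 0 0, ?_, ?_⟩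
      · have h := Zk.mvA c k (Zk.ones c r c y) c 0 0
        rw [← Zk.ones_y, ← hy] at h
        simpa using h
      · refine Zk.npos_wins _ 2 _ ?_ _ ?_
        · exact Zk.vpos c k r y 0 hc2 hk (G y c 0 1 (by omega) (by omega))
            (G y (c - 1) 1 1 (by omega) (by omega))
        · obtain ⟨q, hq⟩ := hceven
          omega
end

section
/- For every c >= 1, k >= 1, and every n >= 3c^2 + 6c + 3, no player has a winning strategy in the (c+2)-player (c,k)-nacci Zeckendorf game on n. -/
namespace CkAux

/-- unfolding of `nacci` -/
lemma nacci_succ_le (c k : ℕ) (hc : 1 ≤ c) (i : ℕ) : nacci c k (i + 1) ≤ nacci c k (i + 2) := by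
  rw [nacci.eq_3]
  split_ifs with h
  · rw [Finset.sum_attach (Finset.range (i + 1)) (fun j => nacci c k (j + 1))]
    have : nacci c k (i + 1) ≤ ∑ j ∈ Finset.range (i + 1), nacci c k (j + 1) :=
      Finset.single_le_sum (f := fun j => nacci c k (j + 1)) (fun _ _ => Nat.zero_le _)
        (Finset.mem_range.2 (Nat.lt_succ_self i))
    nlinarith
  · rw [Finset.sum_attach (Finset.Icc (i + 1 - k) (i + 1)) (fun j => nacci c k j)]
    have : nacci c k (i + 1) ≤ ∑ j ∈ Finset.Icc (i + 1 - k) (i + 1), nacci c k j :=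
      Finset.single_le_sum (f := fun j => nacci c k j) (fun _ _ => Nat.zero_le _)
        (Finset.mem_Icc.2 ⟨by omega, le_rfl⟩)
    nlinarith

lemma nacci_pos (c k : ℕ) (hc : 1 ≤ c) (i : ℕ) : 0 < nacci c k (i + 1) := by
  induction i with
  | zero => simp [nacci]
  | succ i ih => exact lt_of_lt_of_le ih (nacci_succ_le c k hc i)

lemma nacci_succ_lt (c k : ℕ) (hc : 1 ≤ c) (hk : 1 ≤ k) (i : ℕ) :
    nacci c k (i + 1) < nacci c k (i + 2) := by
  rw [nacci.eq_3]
  split_ifs with h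
  · rw [Finset.sum_attach (Finset.range (i + 1)) (fun j => nacci c k (j + 1))]
    have : nacci c k (i + 1) ≤ ∑ j ∈ Finset.range (i + 1), nacci c k (j + 1) :=
      Finset.single_le_sum (f := fun j => nacci c k (j + 1)) (fun _ _ => Nat.zero_le _)
        (Finset.mem_range.2 (Nat.lt_succ_self i))
    nlinarith
  · rw [Finset.sum_attach (Finset.Icc (i + 1 - k) (i + 1)) (fun j => nacci c k j)]
    obtain ⟨i, rfl⟩ : ∃ i', i = i' + 1 := ⟨i - 1, by omega⟩
    have h2 : ∑ j ∈ ({i + 1, i + 1 + 1} : Finset ℕ), nacci c k j ≤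
        ∑ j ∈ Finset.Icc (i + 1 + 1 - k) (i + 1 + 1), nacci c k j := by
      apply Finset.sum_le_sum_of_subset
      intro j hj
      simp only [Finset.mem_insert, Finset.mem_singleton] at hj
      simp only [Finset.mem_Icc]
      omega
    rw [Finset.sum_pair (by omega)] at h2
    have := nacci_pos c k hc i
    nlinarith

lemma nacci_inj (c k : ℕ) (hc : 1 ≤ c) (hk : 1 ≤ k) {i j : ℕ} (hi : 1 ≤ i) (hj : 1 ≤ j)
    (h : nacci c k i = nacci c k j) : i = j := by
  have hm : StrictMono (fun i => nacci c k (i + 1)) :=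
    strictMono_nat_of_lt_succ (fun i => nacci_succ_lt c k hc hk i)
  obtain ⟨i, rfl⟩ : ∃ i', i = i' + 1 := ⟨i - 1, by omega⟩
  obtain ⟨j, rfl⟩ : ∃ i', j = i' + 1 := ⟨j - 1, by omega⟩
  have := hm.injective h
  omega

/-- number of ones consumed by the move producing `S_3` from `c` copies of `S_2` -/
def ee (c k : ℕ) : ℕ := if k = 1 then c else c + 1

/-- position -/
def pos (c k x a b d : ℕ) : Multiset ℕ :=
  Multiset.replicate x (nacci c k 1) + Multiset.replicate a (nacci c k 2)
    + Multiset.replicate b (nacci c k 3) + Multiset.replicate d (nacci c k 4)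

lemma count_pos (c k : ℕ) (hc : 1 ≤ c) (hk : 1 ≤ k) (x a b i : ℕ) (hi : 1 ≤ i) :
    Multiset.count (nacci c k i) (pos c k x a b 0) =
      if i = 1 then x else if i = 2 then a else if i = 3 then b else 0 := by
  have e : ∀ j, 1 ≤ j → (nacci c k j = nacci c k i ↔ i = j) := fun j hj =>
    ⟨fun h => (nacci_inj c k hc hk hj hi h).symm, fun h => by rw [h]⟩
  simp only [pos, Multiset.count_add, Multiset.count_replicate, e 1 le_rfl, e 2 (by omega),
    e 3 (by omega), e 4 (by omega)]
  split_ifs <;> omega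

lemma block_le (c k : ℕ) (s : Finset ℕ) (j : ℕ) (hj : j ∈ s) :
    Multiset.replicate c (nacci c k j) ≤ nacciBlock c k s := by
  unfold nacciBlock
  exact Multiset.le_bind s.val (f := fun j => Multiset.replicate c (nacci c k j))
    hj

lemma le_count (c k : ℕ) (hc : 1 ≤ c) (hk : 1 ≤ k) (x a b i r : ℕ) (hi : 1 ≤ i)
    (h : Multiset.replicate r (nacci c k i) ≤ pos c k x a b 0) :
    r ≤ if i = 1 then x else if i = 2 then a else if i = 3 then b else 0 := by
  rw [← count_pos c k hc hk x a b i hi]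
  exact Multiset.le_count_iff_replicate_le.2 h

lemma block_pair (c k i : ℕ) : nacciBlock c k (Finset.Icc i (i + 1)) =
    Multiset.replicate c (nacci c k i) + Multiset.replicate c (nacci c k (i + 1)) := by
  have : Finset.Icc i (i + 1) = {i, i + 1} := by
    ext; simp only [Finset.mem_Icc, Finset.mem_insert, Finset.mem_singleton]; omega
  rw [this, nacciBlock, Finset.insert_val_of_notMem (by simp)]
  simp

lemma block_single (c k i : ℕ) : nacciBlock c k (Finset.Icc i i) =
    Multiset.replicate c (nacci c k i) := by
  simp [nacciBlock]

lemma block_triple (c k i : ℕ) : nacciBlock c k (Finset.Icc i (i + 2)) =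
    Multiset.replicate c (nacci c k i) + Multiset.replicate c (nacci c k (i + 1))
     + Multiset.replicate c (nacci c k (i + 2)) := by
  have : Finset.Icc i (i + 2) = {i, i + 1, i + 2} := by
    ext; simp only [Finset.mem_Icc, Finset.mem_insert, Finset.mem_singleton]; omega
  rw [this, nacciBlock, Finset.insert_val_of_notMem (by simp),
    Finset.insert_val_of_notMem (by simp)]
  simp [add_assoc]

lemma pos_add (c k x a b d x' a' b' d' : ℕ) :
    pos c k (x + x') (a + a') (b + b') (d + d') = pos c k x a b d + pos c k x' a' b' d' := by
  simp only [pos, Multiset.replicate_add]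
  abel

/-- ones produced when `c+1` copies of `S_3` are merged -/
def ff (c k : ℕ) : ℕ := if k = 1 then c else if k = 2 then 1 else 0

lemma sub_pos' (c k x a b x' a' b' : ℕ) (hx : x' ≤ x) (ha : a' ≤ a) (hb : b' ≤ b) :
    pos c k x a b 0 - pos c k x' a' b' 0 = pos c k (x - x') (a - a') (b - b') 0 := by
  have := pos_add c k (x - x') (a - a') (b - b') 0 x' a' b' 0
  rw [Nat.sub_add_cancel hx, Nat.sub_add_cancel ha, Nat.sub_add_cancel hb] at this
  rw [this, add_tsub_cancel_right]

/-- classification of moves -/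
lemma classify (c k : ℕ) (hc : 1 ≤ c) (hk : 1 ≤ k) (x a b : ℕ) (y : Multiset ℕ)
    (h : CkMove c k (pos c k x a b 0) y) :
    (c + 1 ≤ x ∧ y = pos c k (x - (c + 1)) (a + 1) b 0) ∨
    (c ≤ a ∧ ee c k ≤ x ∧ y = pos c k (x - ee c k) (a - c) (b + 1) 0) ∨
    (c ≤ a ∧ c ≤ b) ∨ c + 1 ≤ a ∨
    (c + 1 ≤ b ∧ y = pos c k (x + ff c k) a (b - (c + 1)) 1) := by
  have r1 : ∀ r, Multiset.replicate r (nacci c k 1) = pos c k r 0 0 0 := by intro r; simp [pos]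
  have r2 : ∀ r, Multiset.replicate r (nacci c k 2) = pos c k 0 r 0 0 := by intro r; simp [pos]
  have r3 : ∀ r, Multiset.replicate r (nacci c k 3) = pos c k 0 0 r 0 := by intro r; simp [pos]
  have s1 : ({nacci c k 1} : Multiset ℕ) = pos c k 1 0 0 0 := by simp [pos]
  have s2 : ({nacci c k 2} : Multiset ℕ) = pos c k 0 1 0 0 := by simp [pos]
  have s3 : ({nacci c k 3} : Multiset ℕ) = pos c k 0 0 1 0 := by simp [pos]
  have s4 : ({nacci c k 4} : Multiset ℕ) = pos c k 0 0 0 1 := by simp [pos]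
  have LC := le_count c k hc hk x a b
  rcases h with ⟨i, hi, hle, rfl⟩ | ⟨i, hi, hik, hle, rfl⟩ | ⟨hle, rfl⟩ | ⟨i, hi, hik, hle, rfl⟩ |
    ⟨hle, rfl⟩ | ⟨i, hi, hle, rfl⟩
  · have h1 := LC i c (by omega)
      ((block_le c k _ i (Finset.mem_Icc.2 ⟨by omega, le_rfl⟩)).trans hle)
    have h2 := LC (i - 1) c (by omega)
      ((block_le c k _ (i - 1) (Finset.mem_Icc.2 ⟨by omega, by omega⟩)).trans hle)
    by_cases i2 : i = 2
    · subst i2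
      obtain rfl : k = 1 := by omega
      right; left
      simp at h1 h2
      refine ⟨h1, by simpa [ee] using h2, ?_⟩
      rw [show (2 - 1 : ℕ) = 1 from rfl, block_pair c 1 1, r1, r2, ← pos_add, sub_pos', s3,
        ← pos_add] <;> simp [ee, h1, h2]
    · by_cases i3 : i = 3
      · subst i3
        simp at h1 h2
        tauto
      · exfalso
        split_ifs at h1 <;> omega
  · have h1 := LC i c (by omega)
      ((block_le c k _ i (Finset.mem_Icc.2 ⟨by omega, le_rfl⟩)).trans
        ((Multiset.le_add_left _ _).trans hle))
    have h2 := LC 2 c (by omega)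
      ((block_le c k _ 2 (Finset.mem_Icc.2 ⟨by omega, by omega⟩)).trans
        ((Multiset.le_add_left _ _).trans hle))
    have h3 := LC 1 (c + 1) (by omega) ((Multiset.le_add_right _ _).trans hle)
    by_cases i2 : i = 2
    · subst i2
      right; left
      have hk1 : k ≠ 1 := by omega
      simp at h1 h3
      refine ⟨h1, by simpa [ee, hk1] using h3, ?_⟩
      rw [block_single, r1, r2, ← pos_add, sub_pos', s3,
        ← pos_add] <;> simp [ee, h1, h3, hk1]
    · by_cases i3 : i = 3
      · subst i3
        simp at h1 h2
        tauto
      · exfalso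
        split_ifs at h1 <;> omega
  · have h3 := LC 1 (c + 1) (by omega) hle
    simp at h3
    left
    refine ⟨h3, ?_⟩
    rw [r1, sub_pos', s2, ← pos_add] <;> simp [h3]
  · have h1 := LC i (c + 1) (by omega) hle
    by_cases i2 : i = 2
    · subst i2
      simp at h1
      tauto
    · by_cases i3 : i = 3
      · subst i3
        simp at h1
        right; right; right; right
        refine ⟨h1, ?_⟩
        have hk1 : k ≠ 1 := by omega
        have hk2 : k ≠ 2 := by omega
        rw [r3, sub_pos', s4, ← pos_add] <;> simp [h1, ff, hk1, hk2]
      · exfalso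
        split_ifs at h1 <;> omega
  · have h1 := LC (k + 1) (c + 1) (by omega) hle
    by_cases i2 : k = 1
    · subst i2
      simp at h1
      tauto
    · by_cases i3 : k = 2
      · subst i3
        simp at h1
        right; right; right; right
        refine ⟨h1, ?_⟩
        rw [Multiset.insert_eq_cons, ← Multiset.singleton_add, r3, sub_pos', s4, s1, ← pos_add,
          ← pos_add] <;> simp [h1, ff]
      · exfalso
        split_ifs at h1 <;> omega
  · have h1 := LC i (c + 1) (by omega) hle
    by_cases i3 : i = 3
    · subst i3
      obtain rfl : k = 1 := by omega
      simp at h1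
      right; right; right; right
      refine ⟨h1, ?_⟩
      rw [show (3 - 1 - 1 : ℕ) = 1 from rfl, r1, r3, sub_pos', s4, ← pos_add,
        ← pos_add] <;> simp [h1, ff]
    · exfalso
      split_ifs at h1 <;> omega

lemma moveA (c k x a b d : ℕ) :
    CkMove c k (pos c k (x + (c + 1)) a b d) (pos c k x (a + 1) b d) := by
  right; right; left
  have r1 : Multiset.replicate (c + 1) (nacci c k 1) = pos c k (c + 1) 0 0 0 := by simp [pos]
  have s2 : ({nacci c k 2} : Multiset ℕ) = pos c k 0 1 0 0 := by simp [pos]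
  rw [r1, s2, show pos c k (x + (c + 1)) a b d = pos c k x a b d + pos c k (c + 1) 0 0 0 by
    rw [← pos_add]; rfl]
  refine ⟨Multiset.le_add_left _ _, ?_⟩
  rw [add_tsub_cancel_right, ← pos_add]
  rfl

lemma moveB (c k : ℕ) (hk : 1 ≤ k) (x a b d : ℕ) :
    CkMove c k (pos c k (x + ee c k) (a + c) b d) (pos c k x a (b + 1) d) := by
  have s3 : ({nacci c k 3} : Multiset ℕ) = pos c k 0 0 1 0 := by simp [pos]
  have key : pos c k (x + ee c k) (a + c) b d = pos c k x a b d + pos c k (ee c k) c 0 0 := by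
    rw [← pos_add]; rfl
  have r : pos c k (ee c k) c 0 0 = Multiset.replicate (ee c k) (nacci c k 1) +
    Multiset.replicate c (nacci c k 2) := by simp [pos]
  by_cases h : k = 1
  · left
    refine ⟨2, by omega, ?_⟩
    subst h
    rw [show (2 - 1 : ℕ) = 1 from rfl, block_pair c 1 1, s3, key]
    have : ee c 1 = c := by simp [ee]
    rw [this] at r ⊢
    rw [← r]
    refine ⟨Multiset.le_add_left _ _, ?_⟩
    rw [add_tsub_cancel_right, ← pos_add]
    rfl
  · right; left
    refine ⟨2, by omega, by omega, ?_⟩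
    rw [block_single, s3, key]
    have : ee c k = c + 1 := by simp [ee, h]
    rw [this] at r ⊢
    rw [← r]
    refine ⟨Multiset.le_add_left _ _, ?_⟩
    rw [add_tsub_cancel_right, ← pos_add]
    rfl

lemma moveC (c k : ℕ) (hk : 1 ≤ k) (x a b d : ℕ) :
    CkMove c k (pos c k x (a + (c + 1)) b d) (pos c k (x + (c + 1 - ee c k)) a (b + 1) d) := by
  have s1 : ({nacci c k 1} : Multiset ℕ) = pos c k 1 0 0 0 := by simp [pos]
  have s3 : ({nacci c k 3} : Multiset ℕ) = pos c k 0 0 1 0 := by simp [pos]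
  have key : pos c k x (a + (c + 1)) b d = pos c k x a b d + pos c k 0 (c + 1) 0 0 := by
    rw [← pos_add]; rfl
  have r2 : Multiset.replicate (c + 1) (nacci c k 2) = pos c k 0 (c + 1) 0 0 := by simp [pos]
  by_cases h : k = 1
  · right; right; right; right; left
    subst h
    have : c + 1 - ee c 1 = 1 := by simp [ee]
    rw [this, Multiset.insert_eq_cons, ← Multiset.singleton_add, s3, s1, r2, key]
    refine ⟨Multiset.le_add_left _ _, ?_⟩
    rw [add_tsub_cancel_right, ← pos_add, ← pos_add]
    rfl
  · right; right; right; left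
    refine ⟨2, by omega, by omega, ?_⟩
    have : c + 1 - ee c k = 0 := by simp [ee, h]
    rw [this, s3, r2, key]
    refine ⟨Multiset.le_add_left _ _, ?_⟩
    rw [add_tsub_cancel_right, ← pos_add]
    rfl

/-- ones consumed by the move making `S_4` from `S_2`, `S_3` (case `c = 1`) -/
def gg (k : ℕ) : ℕ := if k = 1 then 0 else if k = 2 then 1 else 2

lemma moveD (k : ℕ) (hk : 1 ≤ k) (x a b d : ℕ) :
    CkMove 1 k (pos 1 k (x + gg k) (a + 1) (b + 1) d) (pos 1 k x a b (d + 1)) := by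
  have s4 : ({nacci 1 k 4} : Multiset ℕ) = pos 1 k 0 0 0 1 := by simp [pos]
  have key : pos 1 k (x + gg k) (a + 1) (b + 1) d = pos 1 k x a b d + pos 1 k (gg k) 1 1 0 := by
    rw [← pos_add]; rfl
  have r : pos 1 k (gg k) 1 1 0 = Multiset.replicate (gg k) (nacci 1 k 1) +
    (Multiset.replicate 1 (nacci 1 k 2) + Multiset.replicate 1 (nacci 1 k 3)) := by
      simp [pos, add_assoc]
  by_cases h : k = 1
  · left
    refine ⟨3, by omega, ?_⟩
    subst h
    rw [show (3 - 1 : ℕ) = 2 from rfl, block_pair 1 1 2, s4, key]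
    have : gg 1 = 0 := by simp [gg]
    rw [this] at r ⊢
    rw [Multiset.replicate_zero, zero_add] at r
    rw [← r]
    refine ⟨Multiset.le_add_left _ _, ?_⟩
    rw [add_tsub_cancel_right, ← pos_add]
    rfl
  · by_cases h2 : k = 2
    · left
      refine ⟨3, by omega, ?_⟩
      subst h2
      rw [show (3 - 2 : ℕ) = 1 from rfl, block_triple 1 2 1, s4, key]
      have : gg 2 = 1 := by simp [gg]
      rw [this] at r ⊢
      rw [← add_assoc] at r
      rw [← r]
      refine ⟨Multiset.le_add_left _ _, ?_⟩
      rw [add_tsub_cancel_right, ← pos_add]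
      rfl
    · right; left
      refine ⟨3, by omega, by omega, ?_⟩
      rw [block_pair 1 k 2, s4, key]
      have : gg k = 1 + 1 := by simp [gg, h, h2]
      rw [this] at r ⊢
      rw [← r]
      refine ⟨Multiset.le_add_left _ _, ?_⟩
      rw [add_tsub_cancel_right, ← pos_add]
      rfl

section game
variable {Move : Multiset ℕ → Multiset ℕ → Prop} {p m : ℕ}

lemma win_opp {t : ℕ} {x y : Multiset ℕ} (h : AllianceWins Move p (fun q => q = m) t x)
    (ht : t % p + 1 ≠ m) (hm : Move x y) : AllianceWins Move p (fun q => q = m) (t + 1) y := by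
  cases h with
  | endMove _ _ B hturn _ _ => exact absurd hturn ht
  | contMove _ _ B hturn _ _ => exact absurd hturn ht
  | oppMove _ _ hturn hex hall => exact hall y hm

lemma win_own {t : ℕ} {x : Multiset ℕ} (h : AllianceWins Move p (fun q => q = m) t x)
    (ht : t % p + 1 = m) : ∃ y, Move x y ∧
      ((∃ z, Move y z) → AllianceWins Move p (fun q => q = m) (t + 1) y) := by
  cases h with
  | endMove _ _ B hturn hm hterm => exact ⟨B, hm, fun ⟨z, hz⟩ => absurd hz (hterm z)⟩
  | contMove _ _ B hturn hm hw => exact ⟨B, hm, fun _ => hw⟩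
  | oppMove _ _ hturn hex hall => exact absurd ht hturn

lemma win_not_terminal {t : ℕ} {x : Multiset ℕ}
    (h : AllianceWins Move p (fun q => q = m) t x) (hx : Terminal Move x) : False := by
  cases h with
  | endMove _ _ B hturn hm hterm => exact hx _ hm
  | contMove _ _ B hturn hm hw => exact hx _ hm
  | oppMove _ _ hturn hex hall => obtain ⟨B, hB⟩ := hex; exact hx _ hB

lemma win_unique {t : ℕ} {x : Multiset ℕ}
    (h : AllianceWins Move p (fun q => q = m) t x) :
    ∀ t', AllianceWins Move p (fun q => q = m) t' x → t ≡ t' [MOD p] := by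
  induction h with
  | endMove t x B hturn hm hterm =>
    intro t' h'
    by_contra hne
    have : t' % p + 1 ≠ m := by
      intro h2
      have h3 : t % p + 1 = m := hturn
      apply hne
      unfold Nat.ModEq
      omega
    exact win_not_terminal (win_opp h' this hm) hterm
  | contMove t x B hturn hm hw ih =>
    intro t' h'
    by_contra hne
    have : t' % p + 1 ≠ m := by
      intro h2
      have h3 : t % p + 1 = m := hturn
      apply hne
      unfold Nat.ModEq
      omega
    exact hne (Nat.ModEq.add_right_cancel' 1 (ih _ (win_opp h' this hm)))
  | oppMove t x hturn hex hall ih =>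
    intro t' h'
    cases h' with
    | endMove _ _ B hturn' hm hterm => exact (win_not_terminal (hall _ hm) hterm).elim
    | contMove _ _ B hturn' hm hw => exact Nat.ModEq.add_right_cancel' 1 (ih _ hm _ hw)
    | oppMove _ _ hturn' hex' hall' =>
      obtain ⟨B, hB⟩ := hex
      exact Nat.ModEq.add_right_cancel' 1 (ih _ hB _ (hall' _ hB))

lemma win_clash {t : ℕ} {x : Multiset ℕ} (hp : 2 ≤ p)
    (h : AllianceWins Move p (fun q => q = m) t x)
    (h' : AllianceWins Move p (fun q => q = m) (t + 1) x) : False := by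
  have h1 := win_unique h _ h'
  have h2 : 0 + t ≡ 1 + t [MOD p] := by simpa [add_comm] using h1
  have h3 := Nat.ModEq.add_right_cancel' t h2
  unfold Nat.ModEq at h3
  rw [Nat.zero_mod, Nat.mod_eq_of_lt (by omega)] at h3
  omega

end game

/-- the stand-in for `S_3` -/
def ss (c k : ℕ) : ℕ := c * (c + 1) + ee c k

lemma ee_le (c k : ℕ) : ee c k ≤ c + 1 := by unfold ee; split_ifs <;> omega

/-- position with total `n` -/
def Q (c k n a b : ℕ) : Multiset ℕ := pos c k (n - (a * (c + 1) + b * ss c k)) a b 0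

lemma QA (c k n a b : ℕ) (h : (a + 1) * (c + 1) + b * ss c k ≤ n) :
    CkMove c k (Q c k n a b) (Q c k n (a + 1) b) := by
  have := moveA c k (n - ((a + 1) * (c + 1) + b * ss c k)) a b 0
  unfold Q
  convert this using 2
  rw [add_mul] at *
  omega

lemma QB (c k n a b : ℕ) (hk : 1 ≤ k) (h : a * (c + 1) + (b + 1) * ss c k ≤ n) :
    CkMove c k (Q c k n (a + c) b) (Q c k n a (b + 1)) := by
  have := moveB c k hk (n - (a * (c + 1) + (b + 1) * ss c k)) a b 0
  unfold Q
  convert this using 2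
  have e : ss c k = c * (c + 1) + ee c k := rfl
  rw [add_mul b 1, add_mul a c] at *
  omega

lemma QC (c k n a b : ℕ) (hk : 1 ≤ k) (h : (a + (c + 1)) * (c + 1) + b * ss c k ≤ n) :
    CkMove c k (Q c k n (a + (c + 1)) b) (Q c k n a (b + 1)) := by
  have := moveC c k hk (n - ((a + (c + 1)) * (c + 1) + b * ss c k)) a b 0
  unfold Q
  convert this using 2
  have e : ss c k = c * (c + 1) + ee c k := rfl
  have := ee_le c k
  rw [add_mul b 1, add_mul a (c + 1), add_mul c 1 (c + 1)] at *
  omega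

/-- classification in terms of `Q` -/
lemma classifyQ (c k : ℕ) (hc : 1 ≤ c) (hk : 1 ≤ k) (n a b : ℕ) (y : Multiset ℕ)
    (hn : a * (c + 1) + b * ss c k ≤ n)
    (h : CkMove c k (Q c k n a b) y) :
    y = Q c k n (a + 1) b ∨
    (c ≤ a ∧ y = Q c k n (a - c) (b + 1)) ∨
    (c ≤ a ∧ c ≤ b) ∨ c + 1 ≤ a ∨
    (c + 1 ≤ b ∧ y = pos c k (n - (a * (c + 1) + b * ss c k) + ff c k) a (b - (c + 1)) 1) := by
  rcases classify c k hc hk _ a b y h with ⟨h1, h2⟩ | ⟨h1, h2, h3⟩ | h1 | h1 | h1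
  · left
    rw [h2, Q]
    congr 1
    rw [add_mul]; omega
  · right; left
    refine ⟨h1, ?_⟩
    rw [h3, Q]
    congr 1
    obtain ⟨a, rfl⟩ : ∃ a', a = a' + c := ⟨a - c, by omega⟩
    have e : ss c k = c * (c + 1) + ee c k := rfl
    rw [add_mul b, Nat.add_sub_cancel, add_mul a] at *
    omega
  · tauto
  · tauto
  · tauto

section main
variable {c k n m : ℕ}

/-- winning predicate -/
abbrev W (c k m t : ℕ) (x : Multiset ℕ) : Prop :=
  AllianceWins (CkMove c k) (c + 2) (fun q => q = m) t x

lemma runA (r : ℕ) : ∀ (t a b : ℕ), (∀ i < r, (t + i) % (c + 2) + 1 ≠ m) →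
    (a + r) * (c + 1) + b * ss c k ≤ n → W c k m t (Q c k n a b) →
    W c k m (t + r) (Q c k n (a + r) b) := by
  induction r with
  | zero => intro t a b _ _ h; exact h
  | succ r ih =>
    intro t a b hf hn h
    have h1 := ih t a b (fun i hi => hf i (by omega)) (by nlinarith) h
    exact win_opp h1 (hf r (by omega)) (QA c k n (a + r) b hn)

lemma ss_le : ss c k ≤ (c + 1) * (c + 1) := by
  have := ee_le c k
  unfold ss
  nlinarith

lemma key (hk : 1 ≤ k) {t a b : ℕ} (ha : 1 ≤ a) (hac : a ≤ c)
    (hf : ∀ i < c + 1, (t + i) % (c + 2) + 1 ≠ m)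
    (hn : (c + 1) * (c + 1) + b * ss c k ≤ n) (h : W c k m t (Q c k n a b)) : False := by
  have hs := ss_le (c := c) (k := k)
  have e1 : a + (c - a) = 0 + c := by omega
  have e2 : a + (c + 1 - a) = 0 + (c + 1) := by omega
  have h1 := runA (c - a) t a b (fun i hi => hf i (by omega)) (by rw [e1]; nlinarith) h
  rw [e1] at h1
  have h1' := win_opp h1 (hf _ (by omega)) (QB c k n 0 b hk (by nlinarith))
  have h2 := runA (c + 1 - a) t a b (fun i hi => hf i (by omega)) (by rw [e2]; nlinarith) h
  rw [e2] at h2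
  have h2' := win_opp h2 (hf _ (by omega)) (QC c k n 0 b hk (by nlinarith))
  rw [show t + (c + 1 - a) + 1 = (t + (c - a) + 1) + 1 by omega] at h2'
  exact win_clash (by omega) h1' h2'

lemma key2 (hc : 1 ≤ c) (hk : 1 ≤ k) {t : ℕ}
    (hf : ∀ i < c + 1, (t + i) % (c + 2) + 1 ≠ m)
    (hn : 3 * ((c + 1) * (c + 1)) ≤ n) (h : W c k m t (Q c k n (c + 1) 0)) : False := by
  have hs := ss_le (c := c) (k := k)
  have hb : CkMove c k (Q c k n (c + 1) 0) (Q c k n 1 1) := by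
    have := QB c k n 1 0 hk (by nlinarith)
    rwa [add_comm 1 c] at this
  have h1 := win_opp h (hf 0 (by omega)) hb
  have hC : CkMove c k (Q c k n (c + 1) 0) (Q c k n 0 1) := by
    have := QC c k n 0 0 hk (by nlinarith)
    rwa [zero_add] at this
  have h2 := win_opp h (hf 0 (by omega)) hC
  have h3 := win_opp h2 (hf 1 (by omega)) (QA c k n 0 1 (by nlinarith))
  exact win_clash (by omega) h1 h3

lemma turn {j i : ℕ} (hj : j < c + 2) (hm : m = j + 1) (t : ℕ) (r : ℕ) (ht : t = j + (c + 2) * r + 1)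
    (hi : i < c + 1) : (t + i) % (c + 2) + 1 ≠ m := by
  subst hm ht
  rw [show j + (c + 2) * r + 1 + i = (j + (1 + i)) + (c + 2) * r by ring, Nat.add_mul_mod_self_left]
  intro h
  rcases lt_or_ge (j + (1 + i)) (c + 2) with h1 | h1
  · rw [Nat.mod_eq_of_lt h1] at h; omega
  · rw [Nat.mod_eq_sub_mod h1, Nat.mod_eq_of_lt (by omega)] at h; omega

lemma main (hc : 1 ≤ c) (hk : 1 ≤ k) (hn : 3 * ((c + 1) * (c + 1)) ≤ n) (j : ℕ) (hj : j < c + 2)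
    (hm : m = j + 1) (h : W c k m 0 (Q c k n 0 0)) : False := by
  have hs := ss_le (c := c) (k := k)
  have free0 : ∀ i < j, (0 + i) % (c + 2) + 1 ≠ m := by
    intro i hi
    rw [zero_add, Nat.mod_eq_of_lt (by omega)]; omega
  have fr := fun t r ht i hi => turn (m := m) (c := c) (i := i) hj hm t r ht hi
  have own0 : j % (c + 2) + 1 = m := by rw [Nat.mod_eq_of_lt hj, hm]
  rcases lt_or_ge j c with hjc | hjc
  · have h1 := runA j 0 0 0 free0 (by nlinarith) h
    simp only [zero_add] at h1
    obtain ⟨y, hy, hw⟩ := win_own h1 own0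
    have hy' := classifyQ c k hc hk n j 0 y (by nlinarith) hy
    have : y = Q c k n (j + 1) 0 := by
      rcases hy' with h | h | h | h | h
      · exact h
      all_goals exfalso; omega
    subst this
    have h2 := hw ⟨_, QA c k n (j + 1) 0 (by nlinarith)⟩
    exact key hk (by omega) (by omega) (fr (j + 1) 0 (by ring)) (by nlinarith) h2
  · have h1 := runA c 0 0 0 (fun i hi => free0 i (by omega)) (by nlinarith) h
    simp only [zero_add] at h1
    rcases Nat.eq_or_lt_of_le hjc with hjc | hjc
    · -- j = c
      subst hjc
      obtain ⟨y, hy, hw⟩ := win_own h1 own0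
      have hy' := classifyQ c k hc hk n c 0 y (by nlinarith) hy
      have : y = Q c k n (c + 1) 0 ∨ y = Q c k n 0 1 := by
        rcases hy' with h | h | h | h | h
        · exact Or.inl h
        · right; rw [h.2]; simp
        all_goals exfalso; omega
      rcases this with rfl | rfl
      · have h2 := hw ⟨_, by
          have := QB c k n 1 0 hk (by nlinarith)
          rwa [add_comm 1 c] at this⟩
        exact key2 hc hk (fr (c + 1) 0 (by ring)) (by nlinarith) h2
      · have h2 := hw ⟨_, QA c k n 0 1 (by nlinarith)⟩
        have f2 := fr (c + 1) 0 (by ring)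
        have h3 := runA c _ 0 1 (fun i hi => f2 i (by omega)) (by nlinarith) h2
        have h4 := win_opp h3 (f2 _ (by omega)) (QB c k n 0 1 hk (by nlinarith))
        have own2 : (c + 1 + c + 1) % (c + 2) + 1 = m := by
          rw [show c + 1 + c + 1 = c + (c + 2) by ring, Nat.add_mod_right]; exact own0
        obtain ⟨y, hy, hw⟩ := win_own h4 own2
        have hy' := classifyQ c k hc hk n 0 2 y (by nlinarith) hy
        rcases hy' with rfl | h | h | h | ⟨hc1, rfl⟩
        · have h5 := hw ⟨_, QA c k n 1 2 (by nlinarith)⟩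
          exact key hk (by omega) hc (fr _ 1 (by ring)) (by nlinarith) h5
        · omega
        · omega
        · omega
        · obtain rfl : c = 1 := by omega
          have e3 : n - (0 * (1 + 1) + 2 * ss 1 k) + ff 1 k = n - (2 + ss 1 k + gg k) := by
            unfold ss ee ff gg at *
            split_ifs at * <;> omega
          rw [e3] at hw
          have g2 : 2 + ss 1 k + gg k + 2 ≤ n := by
            unfold ss ee gg
            split_ifs <;> omega
          have h5 := hw ⟨_, by
            have := moveA 1 k (n - (2 + ss 1 k + gg k) - 2) 0 0 1
            rwa [show n - (2 + ss 1 k + gg k) - 2 + (1 + 1) = n - (2 + ss 1 k + gg k) by omega]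
              at this⟩
          have hD : CkMove 1 k (Q 1 k n 1 1) (pos 1 k (n - (2 + ss 1 k + gg k)) 0 0 1) := by
            have := moveD k hk (n - (2 + ss 1 k + gg k)) 0 0 0
            unfold Q
            convert this using 2
            omega
          have h6 := win_opp h3 (f2 _ (by omega)) hD
          exact win_clash (by omega) h6 h5
    · obtain rfl : j = c + 1 := by omega
      have h2 := win_opp h1 (by simpa using free0 c (by omega)) (by simpa using QB c k n 0 0 hk (by nlinarith))
      obtain ⟨y, hy, hw⟩ := win_own h2 own0
      have hy' := classifyQ c k hc hk n 0 1 y (by nlinarith) hy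
      have : y = Q c k n 1 1 := by
        rcases hy' with h | h | h | h | h
        · exact h
        all_goals exfalso; omega
      subst this
      have h3 := hw ⟨_, QA c k n 1 1 (by nlinarith)⟩
      exact key hk (by omega) hc (fr _ 0 (by ring)) (by nlinarith) h3

end main

end CkAux

/-- For every `c ≥ 1`, `k ≥ 1`, and every `n ≥ 3c² + 6c + 3`, no player has a winning
strategy in the `(c+2)`-player `(c,k)`-nacci Zeckendorf game on `n`. -/
theorem multiplayer_ck_nacci_no_winner_c_plus_two_players (c k n : ℕ)
    (hc : 1 ≤ c) (hk : 1 ≤ k) (hn : 3 * c ^ 2 + 6 * c + 3 ≤ n) :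
    ∀ m, 1 ≤ m → m ≤ c + 2 → ¬ PlayerWins (CkMove c k) (c + 2) m n := by
  intro m hm1 hm2 h
  refine CkAux.main (n := n) (m := m) hc hk (by nlinarith) (m - 1) (by omega) (by omega) ?_
  have : CkAux.Q c k n 0 0 = Multiset.replicate n 1 := by
    simp [CkAux.Q, CkAux.pos, nacci]
  rw [this]
  exact h
end
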